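/- arXiv:2007.03082 — 13 statements merged into one kernel-verified Lean document; each statement's English description precedes it below -/
import Mathlib

section
/- Let (V,+,⊡) be a near algebra with multiplicative identity e. If x ∈ V is ⊡-invertible and f ∈ V is ⊡-null, then x + f is ⊡-invertible and its inverse is (x+f)⁻¹ = (e − f) ⊡ x⁻¹. -/
/-- A near algebra: a real vector space with an associative multiplication
that is left-distributive and left-homogeneous, with two-sided identity `e`. -/
structure NearAlg (W : Type*) [AddCommGroup W] [Module ℝ W] where
  mul : W → W → W
  assoc : ∀ x y z, mul (mul x y) z = mul x (mul y z)
  ldistrib : ∀ x y z, mul x (y + z) = mul x y + mul x z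
  lhomog : ∀ (c : ℝ) (x y : W), mul x (c • y) = c • mul x y
  e : W
  mul_e : ∀ x, mul x e = x
  e_mul : ∀ x, mul e x = x

/-- `y` is a two-sided ⊡-inverse of `x`. -/
def NearAlg.IsInv {W : Type*} [AddCommGroup W] [Module ℝ W] (N : NearAlg W) (x y : W) : Prop :=
  N.mul x y = N.e ∧ N.mul y x = N.e

/-- If `x` is ⊡-invertible (with inverse `xi`) and `f` is ⊡-null, then `x + f` is
⊡-invertible with inverse `(e − f) ⊡ x⁻¹`. -/
theorem stmt0 {W : Type*} [AddCommGroup W] [Module ℝ W] (N : NearAlg W)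
    (x xi f : W) (hx : N.IsInv x xi) (hf : ∀ y : W, N.mul y f = f) :
    N.IsInv (x + f) (N.mul (N.e - f) xi) := by
  obtain ⟨h1, h2⟩ := hx
  have key : N.mul (x + f) (N.e - f) = x := by
    have h : N.e - f = N.e + (-1 : ℝ) • f := by rw [neg_one_smul, sub_eq_add_neg]
    rw [h, N.ldistrib, N.lhomog, N.mul_e, hf, neg_one_smul, add_neg_cancel_right]
  refine ⟨?_, ?_⟩
  · rw [← N.assoc, key, h1]
  · rw [N.ldistrib, hf, N.assoc, h2, N.mul_e, sub_add_cancel]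
end

section
/- Let (V,+,⊡) be a near algebra with multiplicative identity e, let x ∈ V be ⊡-invertible, let f ∈ V be ⊡-null, and let α, β, γ ∈ ℝ. If αx + βe or βx⁻¹ + αe is ⊡-invertible, then both αx + βe + γf and βx⁻¹ + αe + γf are ⊡-invertible, and β(αx + βe + γf)⁻¹ + α(βx⁻¹ + αe + γf)⁻¹ + γf = e. -/
/-- If `x` is ⊡-invertible, `f` is ⊡-null and one of `αx + βe`, `βx⁻¹ + αe` is ⊡-invertible,
then both `αx + βe + γf` and `βx⁻¹ + αe + γf` are ⊡-invertible and
`β(αx + βe + γf)⁻¹ + α(βx⁻¹ + αe + γf)⁻¹ + γf = e`. -/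
theorem stmt1 {W : Type*} [AddCommGroup W] [Module ℝ W] (N : NearAlg W)
    (x xi f : W) (hx : N.IsInv x xi) (hf : ∀ y : W, N.mul y f = f)
    (α β γ : ℝ)
    (hinv : (∃ y, N.IsInv (α • x + β • N.e) y) ∨ (∃ y, N.IsInv (β • xi + α • N.e) y)) :
    ∃ y z : W, N.IsInv (α • x + β • N.e + γ • f) y ∧
      N.IsInv (β • xi + α • N.e + γ • f) z ∧
      β • y + α • z + γ • f = N.e := by
  obtain ⟨hx1, hx2⟩ := hx
  have hb : N.mul xi (α • x + β • N.e) = β • xi + α • N.e := by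
    rw [N.ldistrib, N.lhomog, N.lhomog, hx2, N.mul_e, add_comm]
  have ha : N.mul x (β • xi + α • N.e) = α • x + β • N.e := by
    rw [N.ldistrib, N.lhomog, N.lhomog, hx1, N.mul_e, add_comm]
  have hprod : ∀ a b c d, N.IsInv a b → N.IsInv c d → N.IsInv (N.mul a c) (N.mul d b) := by
    rintro a b c d ⟨h1, h2⟩ ⟨h3, h4⟩
    constructor
    · rw [N.assoc, ← N.assoc c d b, h3, N.e_mul, h1]
    · rw [N.assoc, ← N.assoc b a c, h2, N.e_mul, h4]
  have hA : ∃ y, N.IsInv (α • x + β • N.e) y := by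
    rcases hinv with h | ⟨y, hy⟩
    · exact h
    · refine ⟨N.mul y xi, ?_⟩
      rw [← ha]
      exact hprod _ _ _ _ ⟨hx1, hx2⟩ hy
  obtain ⟨ai, hai⟩ := hA
  have ht : ∀ c : ℝ, N.mul (N.e + c • f) (N.e + (-c) • f) = N.e := by
    intro c
    rw [N.ldistrib, N.mul_e, N.lhomog, hf]
    module
  have htr : N.IsInv (N.e + γ • f) (N.e + (-γ) • f) :=
    ⟨ht γ, by simpa only [neg_neg] using ht (-γ)⟩
  have hadd : ∀ a, N.mul a (N.e + γ • f) = a + γ • f := by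
    intro a
    rw [N.ldistrib, N.mul_e, N.lhomog, hf]
  have hy := hprod _ _ _ _ hai htr
  rw [hadd] at hy
  generalize N.mul (N.e + (-γ) • f) ai = y at hy
  refine ⟨y, N.mul y x, hy, ?_, ?_⟩
  · have h := hprod _ _ _ _ ⟨hx2, hx1⟩ hy
    rwa [N.ldistrib, hb, N.lhomog, hf] at h
  · have h := hy.2
    rw [N.ldistrib, N.ldistrib, N.lhomog, N.lhomog, N.lhomog, N.mul_e, hf] at h
    rw [← h]
    abel
end

section
/- Let (V,+,⊡) be a near algebra with multiplicative identity e and suppose (x_{st})_{0≤s<t} is a one-way flow in V. Then there exists a unique h ∈ V such that e + s·h is ⊡-invertible for every s ≥ 0 and x_{st} = (e + s·h)⁻¹ ⊡ (e + t·h) for all 0 ≤ s < t. -/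
/-- A one-way flow on `[0,∞)`: a family `x s t` (for `0 ≤ s < t`) of ⊡-invertible
elements satisfying `x s t ⊡ x t u = x s u` for `0 ≤ s < t < u`, such that
`(x s u − e)/(u − s)` does not depend on `u`. -/
def NearAlg.IsOneWayFlow {W : Type*} [AddCommGroup W] [Module ℝ W]
    (N : NearAlg W) (x : ℝ → ℝ → W) : Prop :=
  (∀ s t : ℝ, 0 ≤ s → s < t → ∃ y, N.IsInv (x s t) y) ∧
  (∀ s t u : ℝ, 0 ≤ s → s < t → t < u → N.mul (x s t) (x t u) = x s u) ∧
  (∀ s u u' : ℝ, 0 ≤ s → s < u → s < u' →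
    (u - s)⁻¹ • (x s u - N.e) = (u' - s)⁻¹ • (x s u' - N.e))

/-- Every one-way flow has a unique generator `h`: `e + s•h` is ⊡-invertible for all
`s ≥ 0` and `x s t = (e + s•h)⁻¹ ⊡ (e + t•h)` for all `0 ≤ s < t`. -/
theorem stmt2 {W : Type*} [AddCommGroup W] [Module ℝ W] (N : NearAlg W)
    (x : ℝ → ℝ → W) (hx : N.IsOneWayFlow x) :
    ∃! h : W,
      (∀ s : ℝ, 0 ≤ s → ∃ y, N.IsInv (N.e + s • h) y) ∧
      (∀ s t : ℝ, 0 ≤ s → s < t → ∀ y, N.IsInv (N.e + s • h) y →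
        x s t = N.mul y (N.e + t • h)) := by
  obtain ⟨h1, h2, h3⟩ := hx
  have key : ∀ t : ℝ, 0 < t → x 0 t = N.e + t • (x 0 1 - N.e) := by
    intro t ht
    have h := h3 0 t 1 le_rfl ht one_pos
    simp only [sub_zero, inv_one, one_smul] at h
    rw [← h, smul_smul, mul_inv_cancel₀ ht.ne', one_smul]
    abel
  refine ⟨x 0 1 - N.e, ⟨?_, ?_⟩, ?_⟩
  · intro s hs
    rcases hs.eq_or_lt with rfl | hs
    · refine ⟨N.e, ?_, ?_⟩ <;> simp [N.mul_e]
    · rw [← key s hs]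
      exact h1 0 s le_rfl hs
  · intro s t hs hst y hy
    rw [← key t (hs.trans_lt hst)]
    rcases hs.eq_or_lt with rfl | hs
    · have h := hy.1
      rw [zero_smul, add_zero, N.e_mul] at h
      rw [h, N.e_mul]
    · rw [← key s hs] at hy
      rw [← h2 0 s t le_rfl hs hst, ← N.assoc, hy.2, N.e_mul]
  · rintro h' ⟨-, hb⟩
    have h := hb 0 1 le_rfl one_pos N.e (by constructor <;> simp [N.mul_e])
    rw [N.e_mul, one_smul] at h
    rw [h]
    abel
end

section
/- Let (V,+,⊡) be a near algebra with multiplicative identity e. If h ∈ V is such that e + s·h is ⊡-invertible for all s ≥ 0, then the family defined by x_{st} = (e + s·h)⁻¹ ⊡ (e + t·h) for 0 ≤ s < t is a one-way flow in V. -/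
/-- If `e + s•h` is ⊡-invertible for all `s ≥ 0` (with inverse `hinv s`), then the family
`x s t = (e + s•h)⁻¹ ⊡ (e + t•h)` is a one-way flow. -/
theorem stmt3 {W : Type*} [AddCommGroup W] [Module ℝ W] (N : NearAlg W)
    (h : W) (hinv : ℝ → W)
    (hhinv : ∀ s : ℝ, 0 ≤ s → N.IsInv (N.e + s • h) (hinv s))
    (x : ℝ → ℝ → W)
    (hx : ∀ s t : ℝ, 0 ≤ s → s < t → x s t = N.mul (hinv s) (N.e + t • h)) :
    N.IsOneWayFlow x := by
  have key : ∀ s u : ℝ, 0 ≤ s → s < u →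
      (u - s)⁻¹ • (x s u - N.e) = N.mul (hinv s) h := by
    intro s u hs hsu
    have h1 : N.e + u • h = (N.e + s • h) + (u - s) • h := by module
    rw [hx s u hs hsu, h1, N.ldistrib, N.lhomog, (hhinv s hs).2, add_sub_cancel_left,
      inv_smul_smul₀ (sub_ne_zero.mpr hsu.ne')]
  refine ⟨?_, ?_, ?_⟩
  · intro s t hs hst
    have ht : 0 ≤ t := hs.trans hst.le
    refine ⟨N.mul (hinv t) (N.e + s • h), ?_, ?_⟩
    · rw [hx s t hs hst, N.assoc, ← N.assoc (N.e + t • h), (hhinv t ht).1, N.e_mul,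
        (hhinv s hs).2]
    · rw [hx s t hs hst, N.assoc, ← N.assoc (N.e + s • h), (hhinv s hs).1, N.e_mul,
        (hhinv t ht).2]
  · intro s t u hs hst htu
    have ht : 0 ≤ t := hs.trans hst.le
    rw [hx s t hs hst, hx t u ht htu, hx s u hs (hst.trans htu), N.assoc,
      ← N.assoc (N.e + t • h), (hhinv t ht).1, N.e_mul]
  · intro s u u' hs hu hu'
    rw [key s u hs hu, key s u' hs hu']
end

section
/- Let V be a real vector space and consider ℝ × V with multiplication (α,a) ⊡ (β,b) = (βα, β·a + b) and identity e = (1,0). Let x_{st} = (ξ_{st}, a_{st}) ∈ ℝ × V for 0 ≤ s < t be a family with ξ_{st} ≠ 0 for all 0 ≤ s < t, satisfying x_{st} ⊡ x_{tu} = x_{su} for all 0 ≤ s < t < u, and such that for every 0 ≤ s < u the element (x_{su} − e)/(u − s) does not depend on u. Then there exist α ≥ 0 and a ∈ V such that for all 0 ≤ s < t, x_{st} = ( (1+αt)/(1+αs), ((t−s)/(1+αs))·a ). -/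
/-- The multiplication of the near algebra `𝒜_V = ℝ × V`:
`(α,a) ⊡ (β,b) = (βα, β•a + b)`. -/
def amul {V : Type*} [AddCommGroup V] [Module ℝ V] (p q : ℝ × V) : ℝ × V :=
  (q.1 * p.1, q.1 • p.2 + q.2)

/-- The identity `e = (1,0)` of `𝒜_V`. -/
def ae (V : Type*) [AddCommGroup V] [Module ℝ V] : ℝ × V := (1, 0)

/-- A one-way flow in `𝒜_V = ℝ × V` whose first coordinates are nonzero is of the form
`x s t = ((1+αt)/(1+αs), ((t−s)/(1+αs))•a)` for some `α ≥ 0` and `a ∈ V`. -/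
theorem stmt4 {V : Type*} [AddCommGroup V] [Module ℝ V]
    (x : ℝ → ℝ → ℝ × V)
    (hne : ∀ s t : ℝ, 0 ≤ s → s < t → (x s t).1 ≠ 0)
    (hflow : ∀ s t u : ℝ, 0 ≤ s → s < t → t < u → amul (x s t) (x t u) = x s u)
    (hlin : ∀ s u u' : ℝ, 0 ≤ s → s < u → s < u' →
      (u - s)⁻¹ • (x s u - ae V) = (u' - s)⁻¹ • (x s u' - ae V)) :
    ∃ α : ℝ, 0 ≤ α ∧ ∃ a : V, ∀ s t : ℝ, 0 ≤ s → s < t →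
      x s t = ((1 + α * t) / (1 + α * s), ((t - s) / (1 + α * s)) • a) := by
  have h0 : ∀ t : ℝ, 0 < t → (x 0 t).1 = 1 + ((x 0 1).1 - 1) * t ∧ (x 0 t).2 = t • (x 0 1).2 := by
    intro t ht
    have h := hlin 0 t 1 le_rfl ht one_pos
    have h1 := congrArg Prod.fst h
    have h2 := congrArg Prod.snd h
    simp [ae] at h1 h2
    constructor
    · rw [← h1]
      field_simp
      ring
    · rw [← h2, smul_smul, mul_inv_cancel₀ ht.ne', one_smul]
  generalize (x 0 1).1 - 1 = α at h0
  generalize (x 0 1).2 = a at h0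
  have hα : 0 ≤ α := by
    by_contra hneg
    have hneg : α < 0 := not_le.mp hneg
    have ht : 0 < -α⁻¹ := by
      have := inv_lt_zero.mpr hneg
      linarith
    apply hne 0 (-α⁻¹) le_rfl ht
    rw [(h0 _ ht).1, mul_neg, mul_inv_cancel₀ hneg.ne]
    ring
  refine ⟨α, hα, a, ?_⟩
  intro s t hs hst
  have ht : 0 < t := lt_of_le_of_lt hs hst
  rcases hs.eq_or_lt with rfl | hs'
  · ext1
    · simp [(h0 t ht).1]
    · simp [(h0 t ht).2]
  · have hp : 1 + α * s ≠ 0 := by positivity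
    have h := hflow 0 s t le_rfl hs' hst
    have h1 := congrArg Prod.fst h
    have h2 := congrArg Prod.snd h
    simp only [amul, (h0 t ht).1, (h0 t ht).2, (h0 s hs').1, (h0 s hs').2] at h1 h2
    have e1 : (x s t).1 = (1 + α * t) / (1 + α * s) := by
      rw [eq_div_iff hp, h1]
    ext1
    · exact e1
    · have e2 : (x s t).2 = t • a - (x s t).1 • s • a := by
        rw [← h2]
        abel
      simp only
      rw [e2, e1, smul_smul, ← sub_smul]
      congr 1
      field_simp
      ring
end

section
/- Let V be a real vector space, let L = L(V) be the algebra of linear endomorphisms of V, and consider L² with multiplication (A₁,A₂) ⊡ (B₁,B₂) = (A₁B₁, A₂B₁ + B₂) and identity e = (Id, 0). If (x_{st})_{0≤s<t} is a family of ⊡-invertible elements of L² satisfying x_{st} ⊡ x_{tu} = x_{su} for all 0 ≤ s < t < u, such that (x_{su} − e)/(u − s) does not depend on u for every 0 ≤ s < u, then there exist G, H ∈ L such that Id + sH is invertible in L for all s ≥ 0 and x_{st} = ( (Id + tH)(Id + sH)⁻¹, (t − s)·G·(Id + sH)⁻¹ ) for all 0 ≤ s < t. -/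
/-- The multiplication of the near algebra `L² = L(V) × L(V)`:
`(A₁,A₂) ⊡ (B₁,B₂) = (A₁B₁, A₂B₁ + B₂)`. -/
def emul {V : Type*} [AddCommGroup V] [Module ℝ V]
    (A B : Module.End ℝ V × Module.End ℝ V) : Module.End ℝ V × Module.End ℝ V :=
  (A.1 * B.1, A.2 * B.1 + B.2)

/-- The identity `e = (Id, 0)` of the near algebra `L²`. -/
def ee (V : Type*) [AddCommGroup V] [Module ℝ V] : Module.End ℝ V × Module.End ℝ V := (1, 0)

/-- `B` is a two-sided ⊡-inverse of `A` in `L²`. -/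
def eIsInv {V : Type*} [AddCommGroup V] [Module ℝ V]
    (A B : Module.End ℝ V × Module.End ℝ V) : Prop :=
  emul A B = ee V ∧ emul B A = ee V

/-- A one-way flow in the near algebra `L²` of pairs of endomorphisms is of the form
`x s t = ((Id + tH)(Id + sH)⁻¹, (t−s)•G(Id + sH)⁻¹)` for some `G H : L(V)` with
`Id + sH` invertible for all `s ≥ 0`. -/
theorem stmt5 {V : Type*} [AddCommGroup V] [Module ℝ V]
    (x : ℝ → ℝ → Module.End ℝ V × Module.End ℝ V)
    (hinv : ∀ s t : ℝ, 0 ≤ s → s < t → ∃ y, eIsInv (x s t) y)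
    (hflow : ∀ s t u : ℝ, 0 ≤ s → s < t → t < u → emul (x s t) (x t u) = x s u)
    (hlin : ∀ s u u' : ℝ, 0 ≤ s → s < u → s < u' →
      (u - s)⁻¹ • (x s u - ee V) = (u' - s)⁻¹ • (x s u' - ee V)) :
    ∃ G H : Module.End ℝ V,
      (∀ s : ℝ, 0 ≤ s → IsUnit (1 + s • H)) ∧
      (∀ s t : ℝ, 0 ≤ s → s < t → ∀ K : Module.End ℝ V,
        (1 + s • H) * K = 1 → K * (1 + s • H) = 1 →
        x s t = ((1 + t • H) * K, (t - s) • (G * K))) := by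
  have form : ∀ s t : ℝ, 0 ≤ s → s < t →
      (x s t).1 = 1 + (t - s) • ((x s (s+1)).1 - 1) ∧ (x s t).2 = (t - s) • (x s (s+1)).2 := by
    intro s t hs hst
    have h := hlin s t (s+1) hs hst (by linarith)
    have hne : t - s ≠ 0 := by linarith
    have e1 : s + 1 - s = 1 := by ring
    rw [e1, inv_one, one_smul, inv_smul_eq_iff₀ hne] at h
    have h1 := congrArg Prod.fst h
    have h2 := congrArg Prod.snd h
    simp only [ee, Prod.fst_sub, Prod.snd_sub, Prod.smul_fst, Prod.smul_snd, sub_zero] at h1 h2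
    exact ⟨by rw [← h1]; abel, h2⟩
  obtain ⟨h, hh⟩ : ∃ h : ℝ → Module.End ℝ V, ∀ s, h s = (x s (s+1)).1 - 1 := ⟨_, fun _ => rfl⟩
  obtain ⟨g, hg⟩ : ∃ g : ℝ → Module.End ℝ V, ∀ s, g s = (x s (s+1)).2 := ⟨_, fun _ => rfl⟩
  simp only [← hh, ← hg] at form
  have key : ∀ t : ℝ, 0 ≤ t → (1 + t • h 0) * h t = h 0 ∧ g t = g 0 - t • (g 0 * h t) := by
    intro t ht
    rcases ht.eq_or_lt with rfl | ht0
    · simp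
    have hf := hflow 0 t (t+1) le_rfl ht0 (by linarith)
    have h1 := congrArg Prod.fst hf
    have h2 := congrArg Prod.snd hf
    simp only [emul] at h1 h2
    rw [(form 0 t le_rfl ht0).1, (form t (t+1) ht (by linarith)).1,
      (form 0 (t+1) le_rfl (by linarith)).1] at h1
    rw [(form 0 t le_rfl ht0).2, (form t (t+1) ht (by linarith)).1,
      (form t (t+1) ht (by linarith)).2, (form 0 (t+1) le_rfl (by linarith)).2] at h2
    have e1 : t + 1 - t = 1 := by ring
    simp only [e1, sub_zero, one_smul, mul_add, mul_one, add_smul, smul_mul_assoc] at h1 h2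
    constructor
    · rw [← sub_eq_zero] at h1 ⊢
      rw [← h1]; simp only [add_mul, one_mul, smul_mul_assoc]; abel
    · rw [← sub_eq_zero] at h2 ⊢
      rw [← h2]; abel
  refine ⟨g 0, h 0, ?_, ?_⟩
  · intro s hs
    rcases hs.eq_or_lt with rfl | hs0
    · simp
    obtain ⟨y, hy1, hy2⟩ := hinv 0 s le_rfl hs0
    have h1 := congrArg Prod.fst hy1
    have h2 := congrArg Prod.fst hy2
    simp only [emul, ee] at h1 h2
    rw [(form 0 s le_rfl hs0).1, sub_zero] at h1 h2
    exact ⟨⟨_, _, h1, h2⟩, rfl⟩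
  · intro s t hs hst K hK1 hK2
    obtain ⟨k1, k2⟩ := key s hs
    have a1 : h s = K * h 0 := by
      rw [← k1, ← mul_assoc, hK2, one_mul]
    have b1 : K = 1 - s • (K * h 0) := by
      rw [← hK2]; simp [mul_add]
    have b2 : K = 1 - s • (h 0 * K) := by
      rw [← hK1]; simp [add_mul]
    have c : h 0 * K = K * h 0 := by
      have hc : (1 + s • h 0) * h 0 = h 0 * (1 + s • h 0) := by
        simp [mul_add, add_mul]
      calc h 0 * K = K * ((1 + s • h 0) * h 0) * K := by
              rw [← mul_assoc K, hK2, one_mul]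
        _ = K * h 0 := by rw [hc, mul_assoc, mul_assoc, hK1, mul_one]
    refine Prod.ext ?_ ?_
    · rw [(form s t hs hst).1, a1]
      simp only [add_mul, one_mul, smul_mul_assoc, c, sub_smul]
      nth_rewrite 3 [b1]
      abel
    · rw [(form s t hs hst).2, k2, a1]
      have : g 0 * K = g 0 - s • (g 0 * (K * h 0)) := by
        conv_lhs => rw [b1]
        simp [mul_sub]
      simp only [this]
end

section
/- Let (V,+,⋉,⋊) be a double near algebra with identities e_⋉ and e_⋊. Then the family defined by x_{sru} = ((u−s)/(u−r))·e_⋊ + ((s−r)/(u−r))·e_⋉ for 0 ≤ r < s < u is a two-way flow in V: each x_{sru} is both ⋉-invertible and ⋊-invertible, the flow equations x_{sru} ⋊ x_{tsu} = x_{tru} and x_{tru} ⋉ x_{srt} = x_{sru} hold for all 0 ≤ r < s < t < u, and (x_{sru} − e_⋉)/(u−s) + (x_{sru} − e_⋊)/(s−r) = 0 for all 0 ≤ r < s < u. -/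
/-- A double near algebra (DNA): a real vector space with two multiplications `lm` (⋉)
and `rm` (⋊), each associative, left-distributive and left-homogeneous with identities
`el = e_⋉` and `er = e_⋊`, such that `x ⋊ e_⋉ = e_⋉` and `x ⋉ e_⋊ = e_⋊` for all `x`. -/
structure DNA (W : Type*) [AddCommGroup W] [Module ℝ W] where
  lm : W → W → W
  rm : W → W → W
  el : W
  er : W
  lm_assoc : ∀ x y z, lm (lm x y) z = lm x (lm y z)
  rm_assoc : ∀ x y z, rm (rm x y) z = rm x (rm y z)
  lm_add : ∀ x y z, lm x (y + z) = lm x y + lm x z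
  rm_add : ∀ x y z, rm x (y + z) = rm x y + rm x z
  lm_smul : ∀ (c : ℝ) (x y : W), lm x (c • y) = c • lm x y
  rm_smul : ∀ (c : ℝ) (x y : W), rm x (c • y) = c • rm x y
  lm_el : ∀ x, lm x el = x
  el_lm : ∀ x, lm el x = x
  rm_er : ∀ x, rm x er = x
  er_rm : ∀ x, rm er x = x
  rm_el : ∀ x, rm x el = el
  lm_er : ∀ x, lm x er = er

variable {W : Type*} [AddCommGroup W] [Module ℝ W]

/-- `y` is a two-sided ⋉-inverse of `x`. -/
def DNA.LInv (D : DNA W) (x y : W) : Prop := D.lm x y = D.el ∧ D.lm y x = D.el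

/-- `y` is a two-sided ⋊-inverse of `x`. -/
def DNA.RInv (D : DNA W) (x y : W) : Prop := D.rm x y = D.er ∧ D.rm y x = D.er

/-- A two-way flow: a family `x s r u` (for `0 ≤ r < s < u`) of ⋉- and ⋊-invertible
elements satisfying the flow equations `x s r u ⋊ x t s u = x t r u` and
`x t r u ⋉ x s r t = x s r u` for `0 ≤ r < s < t < u`, together with the structure
condition: `(x s r u − e_⋉)/(u−s) + (x s r u − e_⋊)/(s−r)` does not depend on `s ∈ (r,u)`. -/
def DNA.IsTwoWayFlow (D : DNA W) (x : ℝ → ℝ → ℝ → W) : Prop :=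
  (∀ r s u : ℝ, 0 ≤ r → r < s → s < u →
    (∃ y, D.LInv (x s r u) y) ∧ (∃ y, D.RInv (x s r u) y)) ∧
  (∀ r s t u : ℝ, 0 ≤ r → r < s → s < t → t < u →
    D.rm (x s r u) (x t s u) = x t r u ∧ D.lm (x t r u) (x s r t) = x s r u) ∧
  (∀ r s s' u : ℝ, 0 ≤ r → r < s → s < u → r < s' → s' < u →
    (u - s)⁻¹ • (x s r u - D.el) + (s - r)⁻¹ • (x s r u - D.er) =
    (u - s')⁻¹ • (x s' r u - D.el) + (s' - r)⁻¹ • (x s' r u - D.er))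

/-- `h_r = r(1−r)•h + (1−r)•e_⋊ + r•e_⋉`. -/
def DNA.hcurve (D : DNA W) (h : W) (r : ℝ) : W :=
  (r * (1 - r)) • h + (1 - r) • D.er + r • D.el

/-- `h` is a flow generator: `h_u` is ⋉-invertible for every `u > 0`, the elements
`w r u = h_u^{−⋉} ⋉ h_r` are ⋊-invertible and ⋉-invertible for `0 < r < u`, and for all
`0 < r < s < u` the element `w r s^{−⋊} ⋊ w s u^{−⋉}` is ⋉-invertible with
`w r u^{−⋊} ⋊ w s u = (w r s^{−⋊} ⋊ w s u^{−⋉})^{−⋉}`. -/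
def DNA.IsFlowGenerator (D : DNA W) (h : W) : Prop :=
  (∀ u : ℝ, 0 < u → ∃ y, D.LInv (D.hcurve h u) y) ∧
  (∀ r u : ℝ, 0 < r → r < u → ∀ hui, D.LInv (D.hcurve h u) hui →
    ∃ y, D.RInv (D.lm hui (D.hcurve h r)) y) ∧
  (∀ s u : ℝ, 0 < s → s < u → ∀ hui, D.LInv (D.hcurve h u) hui →
    ∃ y, D.LInv (D.lm hui (D.hcurve h s)) y) ∧
  (∀ r s u : ℝ, 0 < r → r < s → s < u →
    ∀ hsi hui wrui wrsi wsui,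
      D.LInv (D.hcurve h s) hsi →
      D.LInv (D.hcurve h u) hui →
      D.RInv (D.lm hui (D.hcurve h r)) wrui →
      D.RInv (D.lm hsi (D.hcurve h r)) wrsi →
      D.LInv (D.lm hui (D.hcurve h s)) wsui →
      ∃ z, D.LInv (D.rm wrsi wsui) z ∧
        D.rm wrui (D.lm hui (D.hcurve h s)) = z)

theorem DNA.lm_comb (D : DNA W) (x : W) (c d : ℝ) :
    D.lm x (c • D.er + d • D.el) = c • D.er + d • x := by
  rw [D.lm_add, D.lm_smul, D.lm_smul, D.lm_er, D.lm_el]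

theorem DNA.rm_comb (D : DNA W) (x : W) (c d : ℝ) :
    D.rm x (c • D.er + d • D.el) = c • x + d • D.el := by
  rw [D.rm_add, D.rm_smul, D.rm_smul, D.rm_er, D.rm_el]

/-- In any DNA, the family `x s r u = ((u−s)/(u−r))•e_⋊ + ((s−r)/(u−r))•e_⋉` is a
two-way flow, and its structure expression vanishes identically. -/
theorem stmt6 (D : DNA W) :
    D.IsTwoWayFlow (fun s r u => ((u - s) / (u - r)) • D.er + ((s - r) / (u - r)) • D.el) ∧
    (∀ r s u : ℝ, 0 ≤ r → r < s → s < u →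
      (u - s)⁻¹ • ((((u - s) / (u - r)) • D.er + ((s - r) / (u - r)) • D.el) - D.el) +
      (s - r)⁻¹ • ((((u - s) / (u - r)) • D.er + ((s - r) / (u - r)) • D.el) - D.er) = 0) := by
  have key : ∀ r s u : ℝ, 0 ≤ r → r < s → s < u →
      (u - s)⁻¹ • ((((u - s) / (u - r)) • D.er + ((s - r) / (u - r)) • D.el) - D.el) +
      (s - r)⁻¹ • ((((u - s) / (u - r)) • D.er + ((s - r) / (u - r)) • D.el) - D.er) = 0 := by
    intro r s u _ h1 h2
    have a1 : u - s ≠ 0 := by linarith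
    have a2 : s - r ≠ 0 := by linarith
    have a3 : u - r ≠ 0 := by linarith
    match_scalars <;> field_simp <;> ring
  refine ⟨⟨?_, ?_, ?_⟩, key⟩
  · intro r s u _ h1 h2
    have a1 : u - s ≠ 0 := by linarith
    have a2 : s - r ≠ 0 := by linarith
    have a3 : u - r ≠ 0 := by linarith
    refine ⟨⟨(-((u - s) / (s - r))) • D.er + ((u - r) / (s - r)) • D.el, ?_, ?_⟩,
      ⟨((u - r) / (u - s)) • D.er + (-((s - r) / (u - s))) • D.el, ?_, ?_⟩⟩ <;>
    simp only [D.lm_comb, D.rm_comb] <;> match_scalars <;> field_simp <;> ring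
  · intro r s t u _ h1 h2 h3
    have a1 : u - s ≠ 0 := by linarith
    have a2 : t - r ≠ 0 := by linarith
    have a3 : u - r ≠ 0 := by linarith
    constructor <;>
    simp only [D.lm_comb, D.rm_comb] <;> match_scalars <;> field_simp <;> ring
  · intro r s s' u h0 h1 h2 h3 h4
    exact (key r s u h0 h1 h2).trans (key r s' u h0 h3 h4).symm
end

section
/- Let (V,+,⋉,⋊) be a double near algebra with identities e_⋉ and e_⋊. If (x_{sru})_{0≤r<s<u} is a two-way flow in V, then there exists a unique h ∈ V such that, with h_r := r(1−r)·h + (1−r)·e_⋊ + r·e_⋉ for r ≥ 0, all the inverses below exist and x_{sru} = (h_u^{−⋉} ⋉ h_r)^{−⋊} ⋊ (h_u^{−⋉} ⋉ h_s) for all 0 ≤ r < s < u. -/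
variable {W : Type*} [AddCommGroup W] [Module ℝ W]

theorem DNA.flow_quad (D : DNA W) (x : ℝ → ℝ → ℝ → W) (hx : D.IsTwoWayFlow x)
    (u : ℝ) (hu : 0 < u) : ∃ c : W, ∀ s : ℝ, 0 < s → s < u →
      x s 0 u = (s * (u - s)) • c + (s * u⁻¹) • D.el + (1 - s * u⁻¹) • D.er := by
  obtain ⟨-, -, h3⟩ := hx
  refine ⟨u⁻¹ • ((u - u/2)⁻¹ • (x (u/2) 0 u - D.el) + (u/2 - 0)⁻¹ • (x (u/2) 0 u - D.er)), ?_⟩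
  intro s hs hsu
  rw [← h3 0 s (u/2) u le_rfl hs hsu (by linarith) (by linarith)]
  have h1 : u - s ≠ 0 := by linarith
  have h2 : s ≠ 0 := hs.ne'
  have h0 : u ≠ 0 := hu.ne'
  rw [sub_zero]
  match_scalars <;> field_simp <;> ring

theorem DNA.hcurve_zero (D : DNA W) (h : W) : D.hcurve h 0 = D.er := by
  simp [DNA.hcurve]

theorem DNA.hcurve_one (D : DNA W) (h : W) : D.hcurve h 1 = D.el := by
  simp [DNA.hcurve]

theorem DNA.lm_hcurve (D : DNA W) (X h : W) (s : ℝ) :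
    D.lm X (D.hcurve h s) = (s * (1 - s)) • D.lm X h + (1 - s) • D.er + s • X := by
  simp only [DNA.hcurve, D.lm_add, D.lm_smul, D.lm_er, D.lm_el]

theorem DNA.flow_key (D : DNA W) (x : ℝ → ℝ → ℝ → W) (hx : D.IsTwoWayFlow x) (h : W)
    (hh : ∀ s : ℝ, 0 < s → s < 1 → x s 0 1 = D.hcurve h s) (u : ℝ) (hu : 0 < u) :
    ∃ y, D.LInv (D.hcurve h u) y ∧
      ∀ s : ℝ, 0 < s → s < u → D.lm y (D.hcurve h s) = x s 0 u := by
  have hx' := hx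
  obtain ⟨h1, h2, -⟩ := hx'
  rcases lt_trichotomy u 1 with hu1 | rfl | hu1
  · obtain ⟨⟨y, hy⟩, -⟩ := h1 0 u 1 le_rfl hu hu1
    rw [hh u hu hu1] at hy
    refine ⟨y, hy, fun s hs hsu => ?_⟩
    have := (h2 0 s u 1 le_rfl hs hsu hu1).2
    rw [hh u hu hu1, hh s hs (hsu.trans hu1)] at this
    rw [← this, ← D.lm_assoc, hy.2, D.el_lm]
  · refine ⟨D.el, ?_, fun s hs hs1 => ?_⟩
    · rw [D.hcurve_one]; exact ⟨D.lm_el _, D.lm_el _⟩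
    · rw [D.el_lm, hh s hs hs1]
  · obtain ⟨c, hc⟩ := D.flow_quad x hx u hu
    obtain ⟨⟨y, hy⟩, -⟩ := h1 0 1 u le_rfl one_pos hu1
    have hX := hc 1 one_pos hu1
    have e := (h2 0 (1/2) 1 u le_rfl (by norm_num) (by norm_num) hu1).2
    rw [hh (1/2) (by norm_num) (by norm_num), D.lm_hcurve,
      hc (1/2) (by norm_num) (by linarith)] at e
    set X := x 1 0 u with hXdef
    have hA : D.lm X h = c := by
      linear_combination (norm := module) (4:ℝ) • e - (2:ℝ) • hX
    have hall : ∀ s : ℝ, D.lm X (D.hcurve h s) =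
        (s * (u - s)) • c + (s * u⁻¹) • D.el + (1 - s * u⁻¹) • D.er := by
      intro s
      rw [D.lm_hcurve, hA]
      linear_combination (norm := module) s • hX
    have hinv : D.lm X (D.hcurve h u) = D.el := by
      rw [hall, mul_inv_cancel₀ hu.ne']; simp
    have hyu : y = D.hcurve h u := by
      rw [← D.el_lm (D.hcurve h u), ← hy.2, D.lm_assoc, hinv, D.lm_el]
    refine ⟨X, ⟨?_, hinv⟩, fun s hs hsu => ?_⟩
    · rw [← hyu]; exact hy.2
    · rw [hall, hc s hs hsu]

theorem stmt7 (D : DNA W) (x : ℝ → ℝ → ℝ → W) (hx : D.IsTwoWayFlow x) :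
    ∃! h : W, ∀ r s u : ℝ, 0 ≤ r → r < s → s < u →
      ∃ hui w, D.LInv (D.hcurve h u) hui ∧
        D.RInv (D.lm hui (D.hcurve h r)) w ∧
        x s r u = D.rm w (D.lm hui (D.hcurve h s)) := by
  obtain ⟨c, hc⟩ := D.flow_quad x hx 1 one_pos
  have hh : ∀ s : ℝ, 0 < s → s < 1 → x s 0 1 = D.hcurve c s := by
    intro s hs hs1
    rw [hc s hs hs1, DNA.hcurve, inv_one]
    module
  refine ⟨c, ?_, ?_⟩
  · intro r s u hr hrs hsu
    obtain ⟨y, hy, hys⟩ := D.flow_key x hx c hh u (by linarith)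
    obtain ⟨h1, h2, -⟩ := hx
    rcases hr.eq_or_lt with rfl | hr
    · refine ⟨y, D.er, hy, ?_, ?_⟩
      · rw [D.hcurve_zero, D.lm_er]; exact ⟨D.rm_er _, D.rm_er _⟩
      · rw [D.er_rm, hys s hrs hsu]
    · obtain ⟨-, w, hw⟩ := h1 0 r u le_rfl hr (hrs.trans hsu)
      refine ⟨y, w, hy, ?_, ?_⟩
      · rw [hys r hr (hrs.trans hsu)]; exact hw
      · rw [hys s (hr.trans hrs) hsu, ← (h2 0 r s u le_rfl hr hrs hsu).1, ← D.rm_assoc, hw.2,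
          D.er_rm]
  · intro h' H
    obtain ⟨y, w, hy, hw, e⟩ := H 0 (1/2) 1 le_rfl (by norm_num) (by norm_num)
    have hy1 : y = D.el := by
      have := hy.1
      rwa [D.hcurve_one, D.el_lm] at this
    subst hy1
    have hw1 : w = D.er := by
      have := hw.1
      rwa [D.hcurve_zero, D.lm_er, D.er_rm] at this
    subst hw1
    rw [D.er_rm, D.el_lm, hh _ (by norm_num) (by norm_num)] at e
    simp only [DNA.hcurve] at e
    linear_combination (norm := module) (-4:ℝ) • e
end

section
/- Let (V,+,⋉,⋊) be a double near algebra with identities e_⋉, e_⋊, and let h ∈ V be such that h_u := u(1−u)·h + (1−u)·e_⋊ + u·e_⋉ is ⋉-invertible for every u > 0 and w_{ru} := h_u^{−⋉} ⋉ h_r is ⋊-invertible for all 0 ≤ r < u. Define x_{sru} := w_{ru}^{−⋊} ⋊ w_{su} for 0 ≤ r < s < u. Then: (a) each x_{sru} is ⋊-invertible and the first flow equation x_{sru} ⋊ x_{tsu} = x_{tru} holds for all 0 ≤ r < s < t < u; (b) the structure condition holds, i.e. (x_{sru} − e_⋉)/(u−s) + (x_{sru} − e_⋊)/(s−r) does not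 depend on s ∈ (r,u) for all 0 ≤ r < u; (c) each x_{s0u} is ⋉-invertible and the second flow equation x_{t0u} ⋉ x_{s0t} = x_{s0u} holds for all 0 < s < t < u. -/
variable {W : Type*} [AddCommGroup W] [Module ℝ W]

/-- If `h_u` is ⋉-invertible for `u > 0` (with inverse `hinv u`) and
`w r u = h_u^{−⋉} ⋉ h_r` is ⋊-invertible for `0 ≤ r < u` (with inverse `winv r u`),
then `x s r u = w r u^{−⋊} ⋊ w s u` is ⋊-invertible, satisfies the first flow
equation and the structure condition, and for `r = 0` each `x s 0 u` is ⋉-invertible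
and the second flow equation holds. -/
theorem stmt8 (D : DNA W) (h : W)
    (hinv : ℝ → W) (hhinv : ∀ u : ℝ, 0 < u → D.LInv (D.hcurve h u) (hinv u))
    (winv : ℝ → ℝ → W)
    (hwinv : ∀ r u : ℝ, 0 ≤ r → r < u → D.RInv (D.lm (hinv u) (D.hcurve h r)) (winv r u))
    (x : ℝ → ℝ → ℝ → W)
    (hx : ∀ r s u : ℝ, 0 ≤ r → r < s → s < u →
      x s r u = D.rm (winv r u) (D.lm (hinv u) (D.hcurve h s))) :
    (∀ r s u : ℝ, 0 ≤ r → r < s → s < u → ∃ y, D.RInv (x s r u) y) ∧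
    (∀ r s t u : ℝ, 0 ≤ r → r < s → s < t → t < u →
      D.rm (x s r u) (x t s u) = x t r u) ∧
    (∀ r s s' u : ℝ, 0 ≤ r → r < s → s < u → r < s' → s' < u →
      (u - s)⁻¹ • (x s r u - D.el) + (s - r)⁻¹ • (x s r u - D.er) =
      (u - s')⁻¹ • (x s' r u - D.el) + (s' - r)⁻¹ • (x s' r u - D.er)) ∧
    (∀ s u : ℝ, 0 < s → s < u → ∃ y, D.LInv (x s 0 u) y) ∧
    (∀ s t u : ℝ, 0 < s → s < t → t < u → D.lm (x t 0 u) (x s 0 t) = x s 0 u) := by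
  have key : ∀ r s u : ℝ, 0 ≤ r → r < s → s < u →
      (u - s)⁻¹ • (x s r u - D.el) + (s - r)⁻¹ • (x s r u - D.er) =
        (u - r) • D.rm (winv r u) (D.lm (hinv u) h) := by
    intro r s u h0 hrs hsu
    have e1 : u - s ≠ 0 := by linarith
    have e2 : s - r ≠ 0 := by linarith
    have e3 : u - r ≠ 0 := by linarith
    have hs : D.hcurve h s = ((u - s) / (u - r)) • D.hcurve h r
        + ((s - r) / (u - r)) • D.hcurve h u + ((u - s) * (s - r)) • h := by
      unfold DNA.hcurve
      match_scalars <;> field_simp <;> ring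
    have hxs : x s r u = ((u - s) / (u - r)) • D.er + ((s - r) / (u - r)) • D.el
        + ((u - s) * (s - r)) • D.rm (winv r u) (D.lm (hinv u) h) := by
      rw [hx r s u h0 hrs hsu, hs]
      simp only [D.lm_add, D.rm_add, D.lm_smul, D.rm_smul]
      rw [(hwinv r u h0 (hrs.trans hsu)).2, (hhinv u (by linarith)).2, D.rm_el]
    rw [hxs]
    match_scalars <;> field_simp <;> ring
  have h00 : D.hcurve h 0 = D.er := by simp [DNA.hcurve]
  have hx0 : ∀ s u : ℝ, 0 < s → s < u → x s 0 u = D.lm (hinv u) (D.hcurve h s) := by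
    intro s u hs hu
    have h1 := (hwinv 0 u le_rfl (hs.trans hu)).1
    rw [h00, D.lm_er, D.er_rm] at h1
    rw [hx 0 s u le_rfl hs hu, h1, D.er_rm]
  refine ⟨?_, ?_, ?_, ?_, ?_⟩
  · intro r s u h0 hrs hsu
    have hr := hwinv r u h0 (hrs.trans hsu)
    have hs := hwinv s u (h0.trans hrs.le) hsu
    refine ⟨D.rm (winv s u) (D.lm (hinv u) (D.hcurve h r)), ?_, ?_⟩
    · rw [hx r s u h0 hrs hsu, D.rm_assoc, ← D.rm_assoc _ (winv s u), hs.1, D.er_rm, hr.2]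
    · rw [hx r s u h0 hrs hsu, D.rm_assoc, ← D.rm_assoc _ (winv r u), hr.1, D.er_rm, hs.2]
  · intro r s t u h0 hrs hst htu
    have hs := hwinv s u (h0.trans hrs.le) (hst.trans htu)
    rw [hx r s u h0 hrs (hst.trans htu), hx s t u (h0.trans hrs.le) hst htu,
      hx r t u h0 (hrs.trans hst) htu, D.rm_assoc, ← D.rm_assoc _ (winv s u), hs.1, D.er_rm]
  · intro r s s' u h0 h1 h2 h3 h4
    rw [key r s u h0 h1 h2, key r s' u h0 h3 h4]
  · intro s u hs hu
    have h1 := hhinv s hs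
    have h2 := hhinv u (hs.trans hu)
    refine ⟨D.lm (hinv s) (D.hcurve h u), ?_, ?_⟩
    · rw [hx0 s u hs hu, D.lm_assoc, ← D.lm_assoc _ (hinv s), h1.1, D.el_lm, h2.2]
    · rw [hx0 s u hs hu, D.lm_assoc, ← D.lm_assoc _ (hinv u), h2.1, D.el_lm, h1.2]
  · intro s t u hs hst htu
    have ht := hhinv t (hs.trans hst)
    rw [hx0 t u (hs.trans hst) htu, hx0 s t hs hst, hx0 s u hs (hst.trans htu),
      D.lm_assoc, ← D.lm_assoc _ (hinv t), ht.1, D.el_lm]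
end

section
/- Let (V,+,⋉,⋊) be a double near algebra with identities e_⋉, e_⋊. Suppose h ∈ V is such that h_u := u(1−u)·h + (1−u)·e_⋊ + u·e_⋉ is ⋉-invertible for each u > 0, the elements w_{ru} := h_u^{−⋉} ⋉ h_r are ⋊-invertible for all 0 < r < u, each w_{ru}^{−⋊} is ⋉-invertible, and the expression (1/(u(u−r)))·(w_{ru}^{−⋊})^{−⋉} + (1/(ru))·e_⋉ − (1/(r(u−r)))·e_⋊ does not depend on u (for u > r, for every fixed r > 0). Then h is a flow generator. -/
variable {W : Type*} [AddCommGroup W] [Module ℝ W]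

theorem DNA.LInv.uniq {D : DNA W} {x y z : W} (h1 : D.LInv x y) (h2 : D.LInv x z) : y = z := by
  rw [← D.lm_el y, ← h2.1, ← D.lm_assoc, h1.2, D.el_lm]

theorem DNA.RInv.uniq {D : DNA W} {x y z : W} (h1 : D.RInv x y) (h2 : D.RInv x z) : y = z := by
  rw [← D.rm_er y, ← h2.1, ← D.rm_assoc, h1.2, D.er_rm]

theorem DNA.LInv.symm {D : DNA W} {x y : W} (h1 : D.LInv x y) : D.LInv y x := ⟨h1.2, h1.1⟩

theorem DNA.LInv.mul {D : DNA W} {x y x' y' : W} (h1 : D.LInv x x') (h2 : D.LInv y y') :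
    D.LInv (D.lm x y) (D.lm y' x') := by
  constructor
  · rw [D.lm_assoc, ← D.lm_assoc y, h2.1, D.el_lm, h1.1]
  · rw [D.lm_assoc, ← D.lm_assoc x', h1.2, D.el_lm, h2.2]

theorem DNA.lag (D : DNA W) (h : W) {r s u : ℝ} (hr : r ≠ 0) (hs : s ≠ 0) (hrs : s - r ≠ 0) :
    D.hcurve h u = (-(u * (u - s) / (r * (s - r)))) • D.hcurve h r
      + (u * (u - r) / (s * (s - r))) • D.hcurve h s + ((u - r) * (u - s) / (r * s)) • D.er := by
  unfold DNA.hcurve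
  match_scalars <;> field_simp <;> ring

/-- the common computation -/
theorem DNA.key (D : DNA W) (h : W) {r s u : ℝ} (hr : r ≠ 0) (hs : s ≠ 0) (hu : u ≠ 0)
    (hrs : s - r ≠ 0) (hru : u - r ≠ 0) {k Wrs Vrs Vru : W}
    (hk : D.LInv (D.hcurve h s) k) (hW : D.RInv (D.lm k (D.hcurve h r)) Wrs)
    (hV : D.LInv Wrs Vrs)
    (hi : (u * (u - r))⁻¹ • Vru + (r * u)⁻¹ • D.el - (r * (u - r))⁻¹ • D.er =
      (s * (s - r))⁻¹ • Vrs + (r * s)⁻¹ • D.el - (r * (s - r))⁻¹ • D.er) :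
    D.rm Wrs (D.lm k (D.hcurve h u)) = D.lm Wrs Vru := by
  have e : Vru = (-(u * (u - s) / (r * (s - r)))) • D.er
      + (u * (u - r) / (s * (s - r))) • Vrs + ((u - r) * (u - s) / (r * s)) • D.el := by
    have h1 : Vru = (u * (u - r)) • (((u * (u - r))⁻¹ • Vru + (r * u)⁻¹ • D.el
        - (r * (u - r))⁻¹ • D.er) - (r * u)⁻¹ • D.el + (r * (u - r))⁻¹ • D.er) := by
      match_scalars <;> field_simp <;> ring
    rw [h1, hi]
    match_scalars <;> field_simp <;> ring
  rw [D.lag h (u := u) hr hs hrs, e]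
  simp only [D.lm_add, D.lm_smul, D.rm_add, D.rm_smul, hk.2, hW.2, hV.1, D.lm_er, D.lm_el,
    D.rm_er, D.rm_el]

/-- Sufficient condition for a flow generator: if `h_u` is ⋉-invertible for `u > 0`,
`w r u = h_u^{−⋉} ⋉ h_r` is ⋊-invertible for `0 < r < u`, each `w r u^{−⋊}` is
⋉-invertible, and the expression
`(1/(u(u−r)))•(w r u^{−⋊})^{−⋉} + (1/(ru))•e_⋉ − (1/(r(u−r)))•e_⋊`
does not depend on `u`, then `h` is a flow generator. -/
theorem stmt9 (D : DNA W) (h : W)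
    (hinv : ℝ → W) (hhinv : ∀ u : ℝ, 0 < u → D.LInv (D.hcurve h u) (hinv u))
    (winv : ℝ → ℝ → W)
    (hwinv : ∀ r u : ℝ, 0 < r → r < u → D.RInv (D.lm (hinv u) (D.hcurve h r)) (winv r u))
    (vinv : ℝ → ℝ → W)
    (hvinv : ∀ r u : ℝ, 0 < r → r < u → D.LInv (winv r u) (vinv r u))
    (hindep : ∀ r u u' : ℝ, 0 < r → r < u → r < u' →
      (u * (u - r))⁻¹ • vinv r u + (r * u)⁻¹ • D.el - (r * (u - r))⁻¹ • D.er =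
      (u' * (u' - r))⁻¹ • vinv r u' + (r * u')⁻¹ • D.el - (r * (u' - r))⁻¹ • D.er) :
    D.IsFlowGenerator h := by
  refine ⟨fun u hu => ⟨_, hhinv u hu⟩, ?_, ?_, ?_⟩
  · intro r u hr hu hui hh
    rw [hh.uniq (hhinv u (hr.trans hu))]
    exact ⟨_, hwinv r u hr hu⟩
  · intro s u hs hu hui hh
    exact ⟨_, hh.symm.mul (hhinv s hs)⟩
  · intro r s u hr hrs hsu hsi hui wrui wrsi wsui h1 h2 h3 h4 h5
    have hs := hr.trans hrs
    have hu := hs.trans hsu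
    have hru := hrs.trans hsu
    obtain rfl := h1.uniq (hhinv s hs)
    obtain rfl := h2.uniq (hhinv u hu)
    obtain rfl := h3.uniq (hwinv r u hr hru)
    obtain rfl := h4.uniq (hwinv r s hr hrs)
    obtain rfl := h5.uniq (h2.symm.mul h1)
    refine ⟨_, ?_, rfl⟩
    rw [D.key h hr.ne' hs.ne' hu.ne' (sub_pos.2 hrs).ne' (sub_pos.2 hru).ne' h1 h4
        (hvinv r s hr hrs) (hindep r u s hr hru hrs),
      D.key h hr.ne' hu.ne' hs.ne' (sub_pos.2 hru).ne' (sub_pos.2 hrs).ne' h2 h3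
        (hvinv r u hr hru) (hindep r s u hr hrs hru)]
    exact (hvinv r s hr hrs).mul (hvinv r u hr hru).symm
end

section
/- Let V be a real vector space with endomorphism algebra L = L(V), and let 𝒧_V be the double near algebra on L² with multiplications (A₁,A₂) ⋉ (B₁,B₂) = (B₁ + A₁B₂, A₂B₂) and (A₁,A₂) ⋊ (B₁,B₂) = (A₁B₁, A₂B₁ + B₂), and identities e_⋉ = (0, Id), e_⋊ = (Id, 0). A family (x_{sru})_{0≤r<s<u} in 𝒧_V is a two-way flow if and only if there exist H, G ∈ L such that b_{rs} := (1−r)(1−s)H + rsG + Id is invertible in L for all 0 ≤ r < s, and x_{sru} = ( ((u−s)/(u−r))·B_{ru}⁻¹ B_{su}, ((s−r)/(u−r))·B_{ur}⁻¹ B_{sr} ) for all 0 ≤ r < s < u, where H_β := (1−β)H + Id (invertible for β > 0, since b_{0β} = H_β), B_{αβ} := H_β b_{αβ} H_β⁻¹ for β > 0, and B_{α0} := H_α. -/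
section

variable {W : Type*} [AddCommGroup W] [Module ℝ W]

/-- `y` is a two-sided inverse of `x` for the multiplication `m` with identity `e`. -/
def InvPair (m : W → W → W) (e : W) (x y : W) : Prop := m x y = e ∧ m y x = e

/-- A two-way flow for a pair of multiplications `lm` (⋉), `rm` (⋊) with identities
`el = e_⋉`, `er = e_⋊`: a family `x s r u` (`0 ≤ r < s < u`) of ⋉- and ⋊-invertible
elements satisfying the flow equations and the structure condition. -/
def IsTwoWayFlowOps (lm rm : W → W → W) (el er : W) (x : ℝ → ℝ → ℝ → W) : Prop :=
  (∀ r s u : ℝ, 0 ≤ r → r < s → s < u →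
    (∃ y, InvPair lm el (x s r u) y) ∧ (∃ y, InvPair rm er (x s r u) y)) ∧
  (∀ r s t u : ℝ, 0 ≤ r → r < s → s < t → t < u →
    rm (x s r u) (x t s u) = x t r u ∧ lm (x t r u) (x s r t) = x s r u) ∧
  (∀ r s s' u : ℝ, 0 ≤ r → r < s → s < u → r < s' → s' < u →
    (u - s)⁻¹ • (x s r u - el) + (s - r)⁻¹ • (x s r u - er) =
    (u - s')⁻¹ • (x s' r u - el) + (s' - r)⁻¹ • (x s' r u - er))

end

section

variable {V : Type*} [AddCommGroup V] [Module ℝ V]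

/-- The multiplication ⋉ of the DNA `𝒧_V`: `(A₁,A₂) ⋉ (B₁,B₂) = (B₁ + A₁B₂, A₂B₂)`. -/
def lmE (A B : Module.End ℝ V × Module.End ℝ V) : Module.End ℝ V × Module.End ℝ V :=
  (B.1 + A.1 * B.2, A.2 * B.2)

/-- The multiplication ⋊ of the DNA `𝒧_V`: `(A₁,A₂) ⋊ (B₁,B₂) = (A₁B₁, A₂B₁ + B₂)`. -/
def rmE (A B : Module.End ℝ V × Module.End ℝ V) : Module.End ℝ V × Module.End ℝ V :=
  (A.1 * B.1, A.2 * B.1 + B.2)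

/-- The identity `e_⋉ = (0, Id)` of `𝒧_V`. -/
def elE (V : Type*) [AddCommGroup V] [Module ℝ V] : Module.End ℝ V × Module.End ℝ V := (0, 1)

/-- The identity `e_⋊ = (Id, 0)` of `𝒧_V`. -/
def erE (V : Type*) [AddCommGroup V] [Module ℝ V] : Module.End ℝ V × Module.End ℝ V := (1, 0)

/-- `b r s = (1−r)(1−s)H + rsG + Id`. -/
noncomputable def bE (H G : Module.End ℝ V) (r s : ℝ) : Module.End ℝ V :=
  ((1 - r) * (1 - s)) • H + (r * s) • G + 1

/-- `B α β = H_β (b α β) H_β⁻¹` for `β > 0`, where `H_β = (1−β)H + Id`, and `B α 0 = H_α`. -/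
noncomputable def BE (H G : Module.End ℝ V) (α β : ℝ) : Module.End ℝ V :=
  if β = 0 then (1 - α) • H + 1
  else ((1 - β) • H + 1) * bE H G α β * Ring.inverse ((1 - β) • H + 1)

/-- `H_u`. -/
noncomputable def hE (H : Module.End ℝ V) (u : ℝ) : Module.End ℝ V := (1 - u) • H + 1

noncomputable def jE (H : Module.End ℝ V) (u : ℝ) : Module.End ℝ V := Ring.inverse (hE H u)

noncomputable def PE (H G : Module.End ℝ V) (s u : ℝ) : Module.End ℝ V :=
  ((u - s) / u) • (bE H G s u * jE H u)

noncomputable def QE (H : Module.End ℝ V) (s u : ℝ) : Module.End ℝ V :=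
  (s / u) • (jE H u * hE H s)

def AllU (H G : Module.End ℝ V) : Prop := ∀ r s : ℝ, 0 ≤ r → r < s → IsUnit (bE H G r s)

theorem bE_symm (H G : Module.End ℝ V) (r s : ℝ) : bE H G r s = bE H G s r := by
  unfold bE; rw [mul_comm r s, mul_comm (1 - r)]

theorem bE_zero (H G : Module.End ℝ V) (u : ℝ) : bE H G 0 u = hE H u := by
  unfold bE hE; module

theorem hE_comm (H : Module.End ℝ V) (r s : ℝ) : hE H r * hE H s = hE H s * hE H r := by
  unfold hE
  simp only [mul_add, add_mul, smul_mul_assoc, mul_smul_comm, mul_one, one_mul]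
  module

theorem key_id (H G : Module.End ℝ V) (r s u : ℝ) :
    (u * (s - r)) • (bE H G r s * hE H u) + (r * (u - s)) • (bE H G s u * hE H r) =
      (s * (u - r)) • (bE H G r u * hE H s) := by
  unfold bE hE
  simp only [mul_add, add_mul, smul_mul_assoc, mul_smul_comm, mul_one, one_mul]
  module

theorem AllU.h {H G : Module.End ℝ V} (U : AllU H G) {u : ℝ} (hu : 0 < u) : IsUnit (hE H u) := by
  rw [← bE_zero H G]; exact U 0 u le_rfl hu

theorem hj {H : Module.End ℝ V} {u : ℝ} (h : IsUnit (hE H u)) : hE H u * jE H u = 1 :=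
  Ring.mul_inverse_cancel _ h

theorem jh {H : Module.End ℝ V} {u : ℝ} (h : IsUnit (hE H u)) : jE H u * hE H u = 1 :=
  Ring.inverse_mul_cancel _ h

theorem j_unit {H : Module.End ℝ V} {u : ℝ} (h : IsUnit (hE H u)) : IsUnit (jE H u) :=
  ⟨⟨_, _, jh h, hj h⟩, rfl⟩

theorem jh_comm (H : Module.End ℝ V) {u : ℝ} (h : IsUnit (hE H u)) (s : ℝ) :
    jE H u * hE H s = hE H s * jE H u := by
  apply h.mul_right_cancel
  rw [mul_assoc, hE_comm, ← mul_assoc, jh h, mul_assoc, jh h, one_mul, mul_one]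

theorem AllU.b {H G : Module.End ℝ V} (U : AllU H G) {r s : ℝ} (hr : 0 ≤ r) (hs : 0 ≤ s)
    (h : r ≠ s) : IsUnit (bE H G r s) := by
  rcases lt_or_gt_of_ne h with h | h
  · exact U r s hr h
  · rw [bE_symm]; exact U s r hs h

theorem BE_pos (H G : Module.End ℝ V) (s : ℝ) {u : ℝ} (hu : 0 < u) :
    BE H G s u = hE H u * bE H G s u * jE H u := by
  unfold BE; rw [if_neg hu.ne']; rfl

theorem BE_zero (H G : Module.End ℝ V) (s : ℝ) : BE H G s 0 = hE H s := by
  unfold BE; rw [if_pos rfl]; rfl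

theorem AllU.B {H G : Module.End ℝ V} (U : AllU H G) {r s : ℝ} (hr : 0 ≤ r) (hs : 0 ≤ s)
    (h : r ≠ s) : IsUnit (BE H G r s) := by
  rcases hs.eq_or_lt with h0 | h0
  · subst h0; rw [BE_zero]; exact U.h (lt_of_le_of_ne hr h.symm)
  · rw [BE_pos _ _ _ h0]; exact ((U.h h0).mul (U.b hr hs h)).mul (j_unit (U.h h0))

theorem AllU.jB {H G : Module.End ℝ V} (U : AllU H G) (s : ℝ) {u : ℝ} (hu : 0 < u) :
    jE H u * BE H G s u = bE H G s u * jE H u := by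
  rw [BE_pos _ _ _ hu, mul_assoc, ← mul_assoc, jh (U.h hu), one_mul]

/-- `B` is affine in its first argument. -/
theorem BE_affine (H G : Module.End ℝ V) (U : AllU H G) {u : ℝ} (hu : 0 ≤ u) :
    ∃ C : Module.End ℝ V, ∀ r s, BE H G s u = BE H G r u + (s - r) • C := by
  rcases hu.eq_or_lt with h0 | h0
  · subst h0
    refine ⟨-H, fun r s => ?_⟩
    rw [BE_zero, BE_zero]; unfold hE; module
  · refine ⟨hE H u * ((u - 1) • H + u • G) * jE H u, fun r s => ?_⟩
    have : bE H G s u = bE H G r u + (s - r) • ((u - 1) • H + u • G) := by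
      unfold bE; module
    rw [BE_pos _ _ _ h0, BE_pos _ _ _ h0, this]
    simp only [mul_add, add_mul, smul_mul_assoc, mul_smul_comm]

noncomputable def aF (H G : Module.End ℝ V) (s r u : ℝ) : Module.End ℝ V :=
  ((u - s) / (u - r)) • (Ring.inverse (BE H G r u) * BE H G s u)

noncomputable def dF (H G : Module.End ℝ V) (s r u : ℝ) : Module.End ℝ V :=
  ((s - r) / (u - r)) • (Ring.inverse (BE H G u r) * BE H G s r)

theorem PE_unit {H G : Module.End ℝ V} (U : AllU H G) {s u : ℝ} (hs : 0 ≤ s) (hu : s < u) :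
    IsUnit (PE H G s u) := by
  have h0 : 0 < u := hs.trans_lt hu
  have : (u - s) / u ≠ 0 := div_ne_zero (sub_pos.2 hu).ne' h0.ne'
  exact ((U s u hs hu).mul (j_unit (U.h h0))).smul (Units.mk0 _ this)

theorem PE_zero {H G : Module.End ℝ V} (U : AllU H G) {u : ℝ} (hu : 0 < u) :
    PE H G 0 u = 1 := by
  unfold PE; rw [bE_zero, hj (U.h hu), sub_zero, div_self hu.ne', one_smul]

theorem QE_zero {H : Module.End ℝ V} {u : ℝ} : QE H 0 u = 0 := by
  unfold QE; rw [zero_div, zero_smul]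

theorem P_aF {H G : Module.End ℝ V} (U : AllU H G) {r s u : ℝ} (hr : 0 ≤ r) (hs : r < s)
    (hu : s < u) : PE H G r u * aF H G s r u = PE H G s u := by
  have h0 : 0 < u := by linarith
  have hB := U.B hr h0.le (by linarith : r < u).ne
  unfold PE aF
  rw [← U.jB r h0, ← U.jB s h0, smul_mul_smul_comm, mul_assoc,
    ← mul_assoc (BE H G r u), Ring.mul_inverse_cancel _ hB, one_mul]
  congr 1
  have : u - r ≠ 0 := by linarith
  field_simp

theorem Q_dF {H G : Module.End ℝ V} (U : AllU H G) {r s u : ℝ} (hr : 0 ≤ r) (hs : r < s)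
    (hu : s < u) : QE H r u * aF H G s r u + dF H G s r u = QE H s u := by
  have h0 : 0 < u := by linarith
  have h1 : u - r ≠ 0 := by linarith
  rcases hr.eq_or_lt with hr0 | hr0
  · subst hr0
    rw [QE_zero, zero_mul, zero_add]
    unfold dF QE
    rw [BE_zero, BE_zero, sub_zero, sub_zero]; rfl
  have hB := U.B h0.le hr (by linarith : r < u).ne'
  have hP := P_aF U hr hs hu
  have hU := (U.h h0)
  have hR := (U.h hr0)
  have hb := U r u hr (by linarith)
  apply (hb.mul (j_unit hR)).mul_left_cancel
  have e1 : bE H G r u * jE H r * dF H G s r u = ((s - r) / (u - r)) • (bE H G r s * jE H r) := by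
    unfold dF
    rw [bE_symm, ← U.jB u hr0, mul_smul_comm, mul_assoc, ← mul_assoc (BE H G u r),
      Ring.mul_inverse_cancel _ hB, one_mul, U.jB s hr0, bE_symm]
  have e2 : bE H G r u * jE H r * (QE H r u * aF H G s r u) = (r / (u - r)) • PE H G s u := by
    rw [← hP]
    unfold QE PE
    rw [jh_comm H hU]
    simp only [smul_mul_assoc, mul_smul_comm, smul_smul]
    rw [mul_assoc (bE H G r u), ← mul_assoc (jE H r), ← mul_assoc (jE H r), jh hR, one_mul,
      mul_assoc]
    congr 1
    field_simp
  rw [mul_add, e1, e2]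
  have k := key_id H G r s u
  apply (hR.mul hU).mul_right_cancel
  unfold PE QE
  simp only [smul_mul_assoc, mul_smul_comm, smul_smul, add_mul]
  have f1 : bE H G r s * jE H r * (hE H r * hE H u) = bE H G r s * hE H u := by
    rw [mul_assoc, ← mul_assoc (jE H r), jh hR, one_mul]
  have f2 : bE H G s u * jE H u * (hE H r * hE H u) = bE H G s u * hE H r := by
    rw [hE_comm, mul_assoc, ← mul_assoc (jE H u), jh hU, one_mul]
  have f3 : bE H G r u * jE H r * (jE H u * hE H s) * (hE H r * hE H u)
      = bE H G r u * hE H s := by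
    rw [jh_comm H hU, mul_assoc, mul_assoc (hE H s), hE_comm H r u, ← mul_assoc (jE H u),
      jh hU, one_mul, mul_assoc, ← mul_assoc (jE H r), jh_comm H hR, mul_assoc (hE H s), jh hR,
      mul_one]
  rw [f1, f2, f3]
  have hu0 := h0.ne'
  linear_combination (norm := (match_scalars <;> field_simp <;> ring)) (1 / (u * (u - r))) • k

theorem PQ {H G : Module.End ℝ V} (U : AllU H G) {s t u : ℝ} (hs : 0 ≤ s) (ht : s < t)
    (hu : t < u) : PE H G s t + PE H G t u * QE H s t = PE H G s u := by
  have ht0 : 0 < t := by linarith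
  have hu0 : 0 < u := by linarith
  have hT := U.h ht0
  have hU := U.h hu0
  apply (hT.mul hU).mul_right_cancel
  unfold PE QE
  simp only [smul_mul_assoc, mul_smul_comm, smul_smul, add_mul]
  have f1 : bE H G s t * jE H t * (hE H t * hE H u) = bE H G s t * hE H u := by
    rw [mul_assoc, ← mul_assoc (jE H t), jh hT, one_mul]
  have f2 : bE H G s u * jE H u * (hE H t * hE H u) = bE H G s u * hE H t := by
    rw [hE_comm, mul_assoc, ← mul_assoc (jE H u), jh hU, one_mul]
  have f3 : bE H G t u * jE H u * (jE H t * hE H s) * (hE H t * hE H u)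
      = bE H G t u * hE H s := by
    rw [jh_comm H hT, mul_assoc, mul_assoc (hE H s), ← mul_assoc (jE H t),
      jh hT, one_mul, mul_assoc, ← mul_assoc (jE H u), jh_comm H hU, mul_assoc (hE H s), jh hU,
      mul_one]
  rw [f1, f2, f3]
  have hu0 := hu0.ne'
  have ht0 := ht0.ne'
  have := congrArg (fun z => (1 / (t * u)) • z) (key_id H G s t u)
  simp only [smul_add, smul_smul] at this
  convert this using 3 <;> field_simp

theorem inv_l {A : Module.End ℝ V × Module.End ℝ V} (h : IsUnit A.2) :
    ∃ y, InvPair lmE (elE V) A y := by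
  obtain ⟨w, hw⟩ := h
  refine ⟨(-A.1 * ↑w⁻¹, ↑w⁻¹), ?_, ?_⟩
  · simp [lmE, elE, ← hw]
  · simp [lmE, elE, ← hw, mul_assoc]

theorem inv_r {A : Module.End ℝ V × Module.End ℝ V} (h : IsUnit A.1) :
    ∃ y, InvPair rmE (erE V) A y := by
  obtain ⟨w, hw⟩ := h
  refine ⟨(↑w⁻¹, -A.2 * ↑w⁻¹), ?_, ?_⟩
  · simp [rmE, erE, ← hw]
  · simp [rmE, erE, ← hw, mul_assoc]

theorem unit_l {A : Module.End ℝ V × Module.End ℝ V} (h : ∃ y, InvPair lmE (elE V) A y) :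
    IsUnit A.2 := by
  obtain ⟨y, h1, h2⟩ := h
  exact ⟨⟨A.2, y.2, congrArg Prod.snd h1, congrArg Prod.snd h2⟩, rfl⟩

theorem unit_r {A : Module.End ℝ V × Module.End ℝ V} (h : ∃ y, InvPair rmE (erE V) A y) :
    IsUnit A.1 := by
  obtain ⟨y, h1, h2⟩ := h
  exact ⟨⟨A.1, y.1, congrArg Prod.fst h1, congrArg Prod.fst h2⟩, rfl⟩

theorem smul_unit {c : ℝ} (hc : c ≠ 0) {A : Module.End ℝ V} (h : IsUnit A) : IsUnit (c • A) :=
  h.smul (Units.mk0 c hc)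

theorem unit_of_smul {c : ℝ} (hc : c ≠ 0) {A : Module.End ℝ V} (h : IsUnit (c • A)) :
    IsUnit A := by
  have := smul_unit (inv_ne_zero hc) h
  rwa [inv_smul_smul₀ hc] at this

theorem aF_mul {H G : Module.End ℝ V} (U : AllU H G) {r s t u : ℝ} (hr : 0 ≤ r) (hs : r < s)
    (ht : s < t) (hu : t < u) : aF H G s r u * aF H G t s u = aF H G t r u := by
  apply (PE_unit U hr (by linarith : r < u)).mul_left_cancel
  rw [← mul_assoc, P_aF U hr hs (by linarith), P_aF U (by linarith) ht hu,
    P_aF U hr (by linarith) hu]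

theorem dF_mul {H G : Module.End ℝ V} (U : AllU H G) {r s t u : ℝ} (hr : 0 ≤ r) (hs : r < s)
    (ht : s < t) (hu : t < u) : dF H G t r u * dF H G s r t = dF H G s r u := by
  have hB := U.B (by linarith : 0 ≤ t) hr (by linarith : r < t).ne'
  unfold dF
  rw [smul_mul_smul_comm, mul_assoc, ← mul_assoc (BE H G t r), Ring.mul_inverse_cancel _ hB,
    one_mul]
  congr 1
  have : t - r ≠ 0 := by linarith
  have : u - r ≠ 0 := by linarith
  field_simp

theorem mix1 {H G : Module.End ℝ V} (U : AllU H G) {r s t u : ℝ} (hr : 0 ≤ r) (hs : r < s)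
    (ht : s < t) (hu : t < u) :
    dF H G s r u * aF H G t s u + dF H G t s u = dF H G t r u := by
  have q1 := eq_sub_of_add_eq' (Q_dF U hr hs (by linarith : s < u))
  have q2 := eq_sub_of_add_eq' (Q_dF U (by linarith : 0 ≤ s) ht hu)
  have q3 := eq_sub_of_add_eq' (Q_dF U hr (by linarith : r < t) hu)
  rw [q1, q2, q3, ← aF_mul U hr hs ht hu]
  noncomm_ring

theorem mix2 {H G : Module.End ℝ V} (U : AllU H G) {r s t u : ℝ} (hr : 0 ≤ r) (hs : r < s)
    (ht : s < t) (hu : t < u) :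
    aF H G s r t + aF H G t r u * dF H G s r t = aF H G s r u := by
  apply (PE_unit U hr (by linarith : r < u)).mul_left_cancel
  have q1 := eq_sub_of_add_eq' (Q_dF U hr hs ht)
  rw [mul_add, ← mul_assoc, P_aF U hr (by linarith : r < t) hu, P_aF U hr hs (by linarith), q1,
    ← PQ U (by linarith : 0 ≤ s) ht hu, ← PQ U hr (by linarith : r < t) hu, ← P_aF U hr hs ht]
  noncomm_ring

theorem bwd (x : ℝ → ℝ → ℝ → Module.End ℝ V × Module.End ℝ V) (H G : Module.End ℝ V)
    (U : AllU H G) (hx : ∀ r s u : ℝ, 0 ≤ r → r < s → s < u →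
      x s r u = (aF H G s r u, dF H G s r u)) :
    IsTwoWayFlowOps lmE rmE (elE V) (erE V) x := by
  refine ⟨fun r s u hr hs hu => ?_, fun r s t u hr hs ht hu => ?_,
    fun r s s' u hr hs hu hs' hu' => ?_⟩
  · rw [hx r s u hr hs hu]
    have a1 : u - r ≠ 0 := by linarith
    have a2 : u - s ≠ 0 := by linarith
    have a3 : s - r ≠ 0 := by linarith
    constructor
    · apply inv_l
      refine smul_unit (div_ne_zero a3 a1) (IsUnit.mul ?_ ?_)
      · exact (U.B (by linarith) hr (by linarith : r < u).ne').ringInverse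
      · exact (U.B (by linarith) hr hs.ne')
    · apply inv_r
      refine smul_unit (div_ne_zero a2 a1) (IsUnit.mul ?_ ?_)
      · exact (U.B hr (by linarith) (by linarith : r < u).ne).ringInverse
      · exact (U.B (by linarith) (by linarith) hu.ne)
  · rw [hx r s u hr hs (by linarith), hx s t u (by linarith) ht hu, hx r t u hr (by linarith) hu,
      hx r s t hr hs ht]
    constructor
    · exact Prod.ext (aF_mul U hr hs ht hu) (mix1 U hr hs ht hu)
    · exact Prod.ext (mix2 U hr hs ht hu) (dF_mul U hr hs ht hu)
  · obtain ⟨C, hC⟩ := BE_affine H G U (by linarith : 0 ≤ u)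
    obtain ⟨D, hD⟩ := BE_affine H G U hr
    have hBu := U.B hr (by linarith : 0 ≤ u) (by linarith : r < u).ne
    have hBr := U.B (by linarith : 0 ≤ u) hr (by linarith : r < u).ne'
    have key : ∀ s, r < s → s < u →
        (u - s)⁻¹ • (x s r u - elE V) + (s - r)⁻¹ • (x s r u - erE V) =
        (Ring.inverse (BE H G r u) * C, -(Ring.inverse (BE H G u r) * D)) := by
      intro s hs hu
      have a1 : u - r ≠ 0 := by linarith
      have a2 : u - s ≠ 0 := by linarith
      have a3 : s - r ≠ 0 := by linarith
      rw [hx r s u hr hs hu]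
      unfold aF dF elE erE
      rw [hC r s, hD u s, mul_add, mul_add, Ring.inverse_mul_cancel _ hBu,
        Ring.inverse_mul_cancel _ hBr, mul_smul_comm, mul_smul_comm]
      apply Prod.ext
      · simp only [Prod.fst_add, Prod.smul_fst, Prod.fst_sub]
        match_scalars <;> field_simp <;> ring
      · simp only [Prod.snd_add, Prod.smul_snd, Prod.snd_sub]
        match_scalars <;> field_simp <;> ring
    rw [key s hs hu, key s' hs' hu']

theorem fwd (x : ℝ → ℝ → ℝ → Module.End ℝ V × Module.End ℝ V)
    (hx : IsTwoWayFlowOps lmE rmE (elE V) (erE V) x) :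
    ∃ H G : Module.End ℝ V, AllU H G ∧ ∀ r s u : ℝ, 0 ≤ r → r < s → s < u →
      x s r u = (aF H G s r u, dF H G s r u) := by
  obtain ⟨hinv, hfl, hst⟩ := hx
  have hCD : ∀ u : ℝ, ∃ C D : Module.End ℝ V, ∀ s, 0 < s → s < u →
      (x s 0 u).1 = ((u - s) / u) • (1 + s • C) ∧
      (x s 0 u).2 = (s / u) • (1 + (u - s) • D) := by
    intro u
    rcases le_or_gt u 0 with h0 | h0
    · exact ⟨0, 0, fun s h1 h2 => by linarith⟩
    set E := (u - u/2)⁻¹ • (x (u/2) 0 u - elE V) + (u/2 - 0)⁻¹ • (x (u/2) 0 u - erE V) with hE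
    refine ⟨E.1, E.2, fun s h1 h2 => ?_⟩
    have := hst 0 s (u/2) u le_rfl h1 h2 (by linarith) (by linarith)
    rw [← hE] at this
    rw [← this]
    have a2 : u - s ≠ 0 := by linarith
    have a3 : s ≠ 0 := by linarith
    have a4 : u ≠ 0 := by linarith
    simp only [elE, erE, Prod.fst_add, Prod.smul_fst, Prod.fst_sub, Prod.snd_add, Prod.smul_snd,
      Prod.snd_sub, sub_zero]
    constructor
    · match_scalars <;> field_simp <;> ring
    · match_scalars <;> field_simp <;> ring
  choose C D hCD using hCD
  have e1 : ∀ t u, 0 < t → t < u → (1 + (u - t) • D u) * D t = D u := by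
    intro t u ht hu
    have h := congrArg Prod.snd (hfl 0 (t/2) t u le_rfl (by linarith) (by linarith) hu).2
    simp only [lmE] at h
    rw [(hCD u t ht hu).2, (hCD t (t/2) (by linarith) (by linarith)).2,
      (hCD u (t/2) (by linarith) (by linarith)).2] at h
    have a : u ≠ 0 := by linarith
    have h := congrArg (fun z => (4 * u / t ^ 2) • z) h
    simp only [mul_add, add_mul, smul_mul_assoc, mul_smul_comm, mul_one, one_mul, smul_add,
      smul_smul] at h ⊢
    rw [← sub_eq_zero] at h ⊢
    rw [← h]
    match_scalars <;> field_simp <;> ring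
  have e2 : ∀ t u, 0 < t → t < u →
      u • C t + (u - t) • ((1 + t • C u) * D t) = t • C u := by
    intro t u ht hu
    have h := congrArg Prod.fst (hfl 0 (t/2) t u le_rfl (by linarith) (by linarith) hu).2
    simp only [lmE] at h
    rw [(hCD u t ht hu).1, (hCD t (t/2) (by linarith) (by linarith)).2,
      (hCD t (t/2) (by linarith) (by linarith)).1,
      (hCD u (t/2) (by linarith) (by linarith)).1] at h
    have a : u ≠ 0 := by linarith
    have h := congrArg (fun z => (4 * u / t) • z) h
    simp only [mul_add, add_mul, smul_mul_assoc, mul_smul_comm, mul_one, one_mul, smul_add,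
      smul_smul] at h ⊢
    rw [← sub_eq_zero] at h ⊢
    rw [← h]
    match_scalars <;> field_simp <;> ring
  have ud : ∀ t u, 0 < t → t < u → IsUnit (1 + (u - t) • D u) := by
    intro t u ht hu
    have := unit_l (hinv 0 t u le_rfl ht hu).1
    rw [(hCD u t ht hu).2] at this
    exact unit_of_smul (div_ne_zero ht.ne' (by linarith)) this
  set H := D 1 with hH
  set G := C 1 with hG
  have main : ∀ u, 0 < u → IsUnit (hE H u) ∧ D u * hE H u = H ∧
      C u * hE H u = (u - 1) • H + u • G := by
    intro u hu
    rcases lt_trichotomy u 1 with h | h | h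
    · have U : IsUnit (hE H u) := by
        have := ud u 1 hu h
        unfold hE; rwa [add_comm]
      have k := e1 u 1 hu h
      have k2 : D u * hE H u = H := by
        apply U.mul_left_cancel
        have : (1 + (1 - u) • D 1) = hE H u := by unfold hE; rw [add_comm]
        rw [this] at k
        rw [← mul_assoc, k, ← hH]
        unfold hE
        simp only [mul_add, add_mul, smul_mul_assoc, mul_smul_comm, mul_one, one_mul]
      refine ⟨U, k2, ?_⟩
      have k3 := congrArg (· * hE H u) (e2 u 1 hu h)
      simp only [one_smul, add_mul, smul_mul_assoc, mul_assoc, k2, one_mul] at k3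
      rw [eq_sub_of_add_eq k3, ← hG]
      unfold hE
      simp only [mul_add, add_mul, smul_mul_assoc, mul_smul_comm, mul_one, one_mul]
      module
    · subst h
      have : hE H 1 = 1 := by unfold hE; simp
      rw [this]; simp [hH, hG]
    · have k := e1 1 u one_pos h
      have K := ud 1 u one_pos h
      have k1 : (1 + (u - 1) • D u) * hE H u = 1 := by
        have : hE H u = 1 - (u - 1) • H := by unfold hE; module
        rw [this, mul_sub, mul_one, mul_smul_comm, ← hH] at *
        rw [k]; simp
      have U : IsUnit (hE H u) := by
        obtain ⟨w, hw⟩ := K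
        rw [← hw] at k1
        have : hE H u = ↑w⁻¹ := by
          rw [← one_mul (hE H u), ← w.inv_mul, mul_assoc, k1, mul_one]
        rw [this]
        exact (w⁻¹).isUnit
      have cm : H * hE H u = hE H u * H := by
        unfold hE
        simp only [mul_add, add_mul, smul_mul_assoc, mul_smul_comm, mul_one, one_mul]
      refine ⟨U, ?_, ?_⟩
      · rw [← k, ← hH, mul_assoc, cm, ← mul_assoc, k1, one_mul]
      · have k3 := e2 1 u one_pos h
        rw [← hH, ← hG, one_smul, add_mul, one_mul] at k3
        have : hE H u = 1 - (u - 1) • H := by unfold hE; module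
        rw [this, mul_sub, mul_one, mul_smul_comm]
        linear_combination (norm := module) (-1 : ℝ) • k3
  have xa : ∀ s u, 0 < s → s < u → (x s 0 u).1 * hE H u = ((u - s) / u) • bE H G s u := by
    intro s u hs hu
    rw [(hCD u s hs hu).1, smul_mul_assoc, add_mul, one_mul, smul_mul_assoc, (main u (by linarith)).2.2]
    congr 1
    unfold hE bE; module
  have xd : ∀ s u, 0 < s → s < u → (x s 0 u).2 = QE H s u := by
    intro s u hs hu
    have U := (main u (by linarith)).1
    apply U.mul_right_cancel
    rw [(hCD u s hs hu).2, smul_mul_assoc, add_mul, one_mul, smul_mul_assoc, (main u (by linarith)).2.1]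
    unfold QE
    rw [jh_comm H U, smul_mul_assoc, mul_assoc, jh U, mul_one]
    congr 1
    unfold hE; module
  have U : AllU H G := by
    intro r s hr hs
    rcases hr.eq_or_lt with h | h
    · subst h; rw [bE_zero]; exact (main s hs).1
    · have := (unit_r (hinv 0 r s le_rfl h hs).2).mul (main s (by linarith)).1
      rw [xa r s h hs] at this
      exact unit_of_smul (div_ne_zero (by linarith) (by linarith)) this
  have xp : ∀ s u, 0 < s → s < u → (x s 0 u).1 = PE H G s u := by
    intro s u hs hu
    have U := (main u (by linarith)).1
    apply U.mul_right_cancel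
    rw [xa s u hs hu]
    unfold PE
    rw [smul_mul_assoc, mul_assoc, jh U, mul_one]
  refine ⟨H, G, U, fun r s u hr hs hu => ?_⟩
  have h0 : 0 < u := by linarith
  have g1 : PE H G r u * (x s r u).1 = PE H G s u ∧
      QE H r u * (x s r u).1 + (x s r u).2 = QE H s u := by
    rcases hr.eq_or_lt with h | h
    · subst h
      rw [PE_zero U h0, QE_zero, one_mul, zero_mul, zero_add]
      exact ⟨xp s u hs hu, xd s u hs hu⟩
    · have := (hfl 0 r s u le_rfl h hs hu).1
      rw [← xp r u h (by linarith), ← xd r u h (by linarith), ← xp s u (by linarith) hu,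
        ← xd s u (by linarith) hu]
      exact ⟨congrArg Prod.fst this, congrArg Prod.snd this⟩
  have g2 : (x s r u).1 = aF H G s r u := by
    apply (PE_unit U hr (by linarith : r < u)).mul_left_cancel
    rw [g1.1, P_aF U hr hs hu]
  refine Prod.ext g2 ?_
  have := g1.2
  rw [g2, ← Q_dF U hr hs hu] at this
  exact add_left_cancel this

/-- A family in the DNA `𝒧_V` of pairs of endomorphisms is a two-way flow iff there are
`H G : L(V)` with every `b r s = (1−r)(1−s)H + rsG + Id` invertible (`0 ≤ r < s`) such that
`x s r u = (((u−s)/(u−r))•(B r u)⁻¹ B s u, ((s−r)/(u−r))•(B u r)⁻¹ B s r)`. -/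
theorem stmt11 (x : ℝ → ℝ → ℝ → Module.End ℝ V × Module.End ℝ V) :
    IsTwoWayFlowOps lmE rmE (elE V) (erE V) x ↔
    ∃ H G : Module.End ℝ V,
      (∀ r s : ℝ, 0 ≤ r → r < s → IsUnit (bE H G r s)) ∧
      (∀ r s u : ℝ, 0 ≤ r → r < s → s < u →
        x s r u = (((u - s) / (u - r)) • (Ring.inverse (BE H G r u) * BE H G s u),
                   ((s - r) / (u - r)) • (Ring.inverse (BE H G u r) * BE H G s r))) := by
  exact ⟨fun h => fwd x h, fun ⟨H, G, U, h⟩ => bwd x H G U h⟩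

end
end

section
/- Let (V,+,⋉,⋊) be a double near algebra with identities e_⋉, e_⋊ that are linearly independent. For β, γ ∈ ℝ, the element h = β·e_⋊ + γ·e_⋉ is a flow generator if and only if γ ∈ [−1, 0] and β + γ ≥ 0. Equivalently, a family {x_{sru} ∈ span{e_⋊, e_⋉} : 0 ≤ r < s < u} is a two-way flow if and only if there exist ρ ∈ [0,1] and α ≥ 0 such that x_{sru} = ((u−s)·b(s,u)/((u−r)·b(r,u)))·e_⋊ + ((s−r)·b(r,s)/((u−r)·b(r,u)))·e_⋉ for all 0 ≤ r < s < u, where b(s,u) = αsu + ρ(s+u) + 1 − ρ. -/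
variable {W : Type*} [AddCommGroup W] [Module ℝ W]

/-- The element `a e_⋊ + c e_⋉`. -/
def DNA.pt (D : DNA W) (a c : ℝ) : W := a • D.er + c • D.el

theorem DNA.lm_pt (D : DNA W) (a c a' c' : ℝ) :
    D.lm (D.pt a c) (D.pt a' c') = D.pt (a' + c' * a) (c' * c) := by
  simp only [DNA.pt, D.lm_add, D.lm_smul, D.lm_el, D.lm_er]
  module

theorem DNA.rm_pt (D : DNA W) (a c a' c' : ℝ) :
    D.rm (D.pt a c) (D.pt a' c') = D.pt (a' * a) (a' * c + c') := by
  simp only [DNA.pt, D.rm_add, D.rm_smul, D.rm_el, D.rm_er]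
  module

theorem DNA.pt_inj (D : DNA W) (hi : LinearIndependent ℝ ![D.el, D.er]) {a c a' c' : ℝ} :
    D.pt a c = D.pt a' c' ↔ a = a' ∧ c = c' := by
  constructor
  · intro h
    rw [LinearIndependent.pair_iff] at hi
    have := hi (c - c') (a - a') (by
      have h2 : D.pt a c - D.pt a' c' = 0 := sub_eq_zero.2 h
      rw [← h2]; simp only [DNA.pt]; module)
    exact ⟨by linarith [this.2], by linarith [this.1]⟩
  · rintro ⟨rfl, rfl⟩; rfl

theorem DNA.el_pt (D : DNA W) : D.el = D.pt 0 1 := by simp [DNA.pt]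

theorem DNA.er_pt (D : DNA W) : D.er = D.pt 1 0 := by simp [DNA.pt]

theorem DNA.linv_iff (D : DNA W) (hi : LinearIndependent ℝ ![D.el, D.er]) (a c : ℝ) (y : W) :
    D.LInv (D.pt a c) y ↔ c ≠ 0 ∧ y = D.pt (-a / c) (1 / c) := by
  have key : c ≠ 0 → D.LInv (D.pt a c) (D.pt (-a / c) (1 / c)) := by
    intro hc
    constructor
    · rw [D.lm_pt, D.el_pt, D.pt_inj hi]; constructor <;> field_simp <;> ring
    · rw [D.lm_pt, D.el_pt, D.pt_inj hi]; constructor <;> field_simp <;> ring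
  constructor
  · rintro ⟨h1, h2⟩
    have hc : c ≠ 0 := by
      rintro rfl
      have : D.lm y (D.pt a 0) = D.pt a 0 := by
        simp [DNA.pt, D.lm_smul, D.lm_er]
      rw [this, D.el_pt, D.pt_inj hi] at h2
      simp at h2
    refine ⟨hc, ?_⟩
    have k := key hc
    rw [← D.lm_el y, ← k.1, ← D.lm_assoc, h2, D.el_lm]
  · rintro ⟨hc, rfl⟩; exact key hc

theorem DNA.rinv_iff (D : DNA W) (hi : LinearIndependent ℝ ![D.el, D.er]) (a c : ℝ) (y : W) :
    D.RInv (D.pt a c) y ↔ a ≠ 0 ∧ y = D.pt (1 / a) (-c / a) := by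
  have key : a ≠ 0 → D.RInv (D.pt a c) (D.pt (1 / a) (-c / a)) := by
    intro hc
    constructor
    · rw [D.rm_pt, D.er_pt, D.pt_inj hi]; constructor <;> field_simp <;> ring
    · rw [D.rm_pt, D.er_pt, D.pt_inj hi]; constructor <;> field_simp <;> ring
  constructor
  · rintro ⟨h1, h2⟩
    have hc : a ≠ 0 := by
      rintro rfl
      have : D.rm y (D.pt 0 c) = D.pt 0 c := by
        simp [DNA.pt, D.rm_smul, D.rm_el]
      rw [this, D.er_pt, D.pt_inj hi] at h2
      simp at h2
    refine ⟨hc, ?_⟩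
    have k := key hc
    rw [← D.rm_er y, ← k.1, ← D.rm_assoc, h2, D.er_rm]
  · rintro ⟨hc, rfl⟩; exact key hc

theorem DNA.hcurve_pt (D : DNA W) (β γ r : ℝ) :
    D.hcurve (β • D.er + γ • D.el) r =
      D.pt ((1 - r) * (1 + r * β)) (r * (1 + (1 - r) * γ)) := by
  simp only [DNA.hcurve, DNA.pt]; module

theorem rho_range (ρ : ℝ) (h : ∀ t : ℝ, 0 < t → 1 - ρ + ρ * t ≠ 0) : 0 ≤ ρ ∧ ρ ≤ 1 := by
  constructor
  · by_contra hn
    push Not at hn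
    refine h ((ρ - 1) / ρ) (div_pos_of_neg_of_neg (by linarith) hn) ?_
    have := hn.ne
    field_simp; ring
  · by_contra hn
    push Not at hn
    refine h ((ρ - 1) / ρ) (div_pos (by linarith) (by linarith)) ?_
    have : ρ ≠ 0 := by linarith
    field_simp; ring

theorem alpha_range (ρ α : ℝ)
    (h : ∀ r u : ℝ, 0 < r → r < u → α * r * u + ρ * (r + u) + 1 - ρ ≠ 0) : 0 ≤ α := by
  by_contra hn
  push Not at hn
  have hd : 0 ≤ (α + 2 * ρ) ^ 2 - 4 * α := by nlinarith [sq_nonneg (α + 2 * ρ)]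
  have hq := Real.sq_sqrt hd
  have h0 := Real.sqrt_nonneg ((α + 2 * ρ) ^ 2 - 4 * α)
  set q := Real.sqrt ((α + 2 * ρ) ^ 2 - 4 * α)
  have hlt : -(α + 2 * ρ) < q := by
    apply lt_of_pow_lt_pow_left₀ 2 h0
    nlinarith
  have hne := hn.ne
  refine h ((-(α + 2 * ρ) - q) / (2 * α)) ((-(α + 2 * ρ) - q) / (2 * α) + 1)
    (div_pos_of_neg_of_neg (by linarith) (by linarith)) (by linarith) ?_
  field_simp
  linear_combination hq

theorem b_pos (ρ α r u : ℝ) (h0 : 0 ≤ ρ) (h1 : ρ ≤ 1) (ha : 0 ≤ α) (hr : 0 ≤ r) (hu : 0 < u) :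
    0 < α * r * u + ρ * (r + u) + 1 - ρ := by
  have e1 : 0 ≤ α * r * u := by positivity
  have e2 : 0 ≤ ρ * r := by positivity
  have e3 : 0 < ρ * u + 1 - ρ := by
    rcases h0.eq_or_lt with h | h
    · subst h; norm_num
    · nlinarith [mul_pos h hu]
  nlinarith

theorem DNA.gen_iff (D : DNA W) (hi : LinearIndependent ℝ ![D.el, D.er]) (β γ : ℝ) :
    D.IsFlowGenerator (β • D.er + γ • D.el) ↔ (γ ∈ Set.Icc (-1 : ℝ) 0 ∧ 0 ≤ β + γ) := by
  unfold DNA.IsFlowGenerator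
  simp only [D.hcurve_pt]
  constructor
  · rintro ⟨H1, H2, -, -⟩
    have K1 : ∀ u : ℝ, 0 < u → u * (1 + (1 - u) * γ) ≠ 0 := by
      intro u hu
      obtain ⟨y, hy⟩ := H1 u hu
      exact ((D.linv_iff hi _ _ _).1 hy).1
    have := rho_range (-γ) (by
      intro t ht h
      apply K1 t ht
      rw [show 1 + (1 - t) * γ = 1 - -γ + -γ * t by ring, h, mul_zero])
    refine ⟨⟨by linarith, by linarith⟩, alpha_range (-γ) (β + γ) ?_⟩
    intro r u hr hru hb
    have hB := K1 u (hr.trans hru)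
    obtain ⟨y, hy⟩ := H2 r u hr hru _ ((D.linv_iff hi _ _ _).2 ⟨hB, rfl⟩)
    rw [D.lm_pt] at hy
    apply ((D.rinv_iff hi _ _ _).1 hy).1
    have hA : (1 - r) * (1 + r * β) * (u * (1 + (1 - u) * γ)) =
        r * (1 + (1 - r) * γ) * ((1 - u) * (1 + u * β)) := by
      linear_combination (u - r) * hb
    generalize u * (1 + (1 - u) * γ) = B at *
    field_simp
    linear_combination hA
  · rintro ⟨⟨hg1, hg0⟩, hbg⟩
    have hB : ∀ u : ℝ, 0 < u → u * (1 + (1 - u) * γ) ≠ 0 := by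
      intro u hu
      have := b_pos (-γ) 0 0 u (by linarith) (by linarith) le_rfl le_rfl hu
      have : 0 < 1 + (1 - u) * γ := by linarith
      positivity
    have hΔ : ∀ r u : ℝ, 0 < r → r < u → (1 - r) * (1 + r * β) * (u * (1 + (1 - u) * γ)) -
        r * (1 + (1 - r) * γ) * ((1 - u) * (1 + u * β)) ≠ 0 := by
      intro r u hr hru
      have h1 := b_pos (-γ) (β + γ) r u (by linarith) (by linarith) hbg hr.le (hr.trans hru)
      have h2 := mul_pos (sub_pos.2 hru) h1
      intro h
      apply h2.ne'
      linear_combination h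
    generalize hAd : (fun r : ℝ => (1 - r) * (1 + r * β)) = A at *
    generalize hBd : (fun r : ℝ => r * (1 + (1 - r) * γ)) = B at *
    have eA : ∀ r : ℝ, (1 - r) * (1 + r * β) = A r := fun r => by rw [← hAd]
    have eB : ∀ r : ℝ, r * (1 + (1 - r) * γ) = B r := fun r => by rw [← hBd]
    simp only [eA, eB] at *
    have a0 : ∀ r u : ℝ, 0 < r → r < u → A r + B r * (-A u / B u) ≠ 0 := by
      intro r u hr hru h
      have := hB u (hr.trans hru)
      apply hΔ r u hr hru
      field_simp at h
      linear_combination h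
    refine ⟨fun u hu => ⟨_, (D.linv_iff hi _ _ _).2 ⟨hB u hu, rfl⟩⟩, ?_, ?_, ?_⟩
    · intro r u hr hru y hy
      obtain ⟨-, rfl⟩ := (D.linv_iff hi _ _ _).1 hy
      rw [D.lm_pt]
      exact ⟨_, (D.rinv_iff hi _ _ _).2 ⟨a0 r u hr hru, rfl⟩⟩
    · intro r u hr hru y hy
      obtain ⟨-, rfl⟩ := (D.linv_iff hi _ _ _).1 hy
      rw [D.lm_pt]
      exact ⟨_, (D.linv_iff hi _ _ _).2
        ⟨mul_ne_zero (hB r hr) (one_div_ne_zero (hB u (hr.trans hru))), rfl⟩⟩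
    · intro r s u hr hrs hsu y1 y2 y3 y4 y5 h1 h2 h3 h4 h5
      obtain ⟨-, rfl⟩ := (D.linv_iff hi _ _ _).1 h1
      obtain ⟨-, rfl⟩ := (D.linv_iff hi _ _ _).1 h2
      rw [D.lm_pt] at h3 h4 h5
      obtain ⟨n3, rfl⟩ := (D.rinv_iff hi _ _ _).1 h3
      obtain ⟨n4, rfl⟩ := (D.rinv_iff hi _ _ _).1 h4
      obtain ⟨n5, rfl⟩ := (D.linv_iff hi _ _ _).1 h5
      refine ⟨_, ?_, rfl⟩
      have bs := hB s (hr.trans hrs)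
      have bu := hB u ((hr.trans hrs).trans hsu)
      have d1 := hΔ r s hr hrs
      have d2 := hΔ s u (hr.trans hrs) hsu
      have d3 := hΔ r u hr (hrs.trans hsu)
      have E : ∀ r u : ℝ, B u ≠ 0 → A r + B r * (-A u / B u) = (A r * B u - B r * A u) / B u := by
        intro r u hu; field_simp; ring
      rw [D.rm_pt, D.lm_pt, D.rm_pt, D.linv_iff hi, D.pt_inj hi]
      rw [E r s bs, E r u bu, E s u bu]
      have F1 : (A s * B u - B s * A u) = (A s * B u - B s * A u) := rfl
      generalize hd1 : A r * B s - B r * A s = Δ1 at *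
      generalize hd2 : A s * B u - B s * A u = Δ2 at *
      generalize hd3 : A r * B u - B r * A u = Δ3 at *
      have pl : B s * Δ3 - Δ2 * B r = B u * Δ1 := by
        rw [← hd1, ← hd2, ← hd3]; ring
      have G : -(Δ2 / B u) / (B s * (1 / B u)) * (-(B r * (1 / B s)) / (Δ1 / B s)) +
          1 / (B s * (1 / B u)) = Δ3 / Δ1 := by
        field_simp
        linear_combination -pl
      rw [G]
      refine ⟨div_ne_zero d3 d1, ?_, ?_⟩
      · field_simp
      · field_simp
        linear_combination pl

theorem DNA.flow_iff (D : DNA W) (hi : LinearIndependent ℝ ![D.el, D.er])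
    (x : ℝ → ℝ → ℝ → W)
    (hx : ∀ r s u : ℝ, 0 ≤ r → r < s → s < u →
        x s r u ∈ Submodule.span ℝ ({D.er, D.el} : Set W)) :
      (D.IsTwoWayFlow x ↔
        ∃ ρ α : ℝ, ρ ∈ Set.Icc (0 : ℝ) 1 ∧ 0 ≤ α ∧
          ∀ r s u : ℝ, 0 ≤ r → r < s → s < u →
            x s r u = D.pt
              ((u - s) * (α * s * u + ρ * (s + u) + 1 - ρ) /
                ((u - r) * (α * r * u + ρ * (r + u) + 1 - ρ)))
              ((s - r) * (α * r * s + ρ * (r + s) + 1 - ρ) /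
                ((u - r) * (α * r * u + ρ * (r + u) + 1 - ρ)))) := by
  have St : ∀ r s u a c : ℝ, (u - s)⁻¹ • (D.pt a c - D.el) + (s - r)⁻¹ • (D.pt a c - D.er) =
      D.pt ((u - s)⁻¹ * a + (s - r)⁻¹ * (a - 1)) ((u - s)⁻¹ * (c - 1) + (s - r)⁻¹ * c) := by
    intro r s u a c
    simp only [DNA.pt]; module
  constructor
  · rintro ⟨H1, H2, H3⟩
    have ex : ∀ s r u : ℝ, ∃ a c : ℝ, 0 ≤ r → r < s → s < u → x s r u = D.pt a c := by
      intro s r u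
      by_cases h : 0 ≤ r ∧ r < s ∧ s < u
      · obtain ⟨a, c, hac⟩ := Submodule.mem_span_pair.1 (hx r s u h.1 h.2.1 h.2.2)
        exact ⟨a, c, fun _ _ _ => hac.symm⟩
      · exact ⟨0, 0, fun h1 h2 h3 => absurd ⟨h1, h2, h3⟩ h⟩
    choose a c hac using ex
    have na : ∀ r s u : ℝ, 0 ≤ r → r < s → s < u → a s r u ≠ 0 ∧ c s r u ≠ 0 := by
      intro r s u h1 h2 h3
      obtain ⟨⟨y, hy⟩, ⟨z, hz⟩⟩ := H1 r s u h1 h2 h3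
      rw [hac s r u h1 h2 h3] at hy hz
      exact ⟨((D.rinv_iff hi _ _ _).1 hz).1, ((D.linv_iff hi _ _ _).1 hy).1⟩
    have st0 : ∀ u : ℝ, 0 < u → ∃ g k : ℝ, ∀ s, 0 < s → s < u →
        u * a s 0 u = (u - s) * (1 + g * s) ∧ u * c s 0 u = s * (1 + k * (u - s)) := by
      intro u hu
      have h2 : 0 < u / 2 := by linarith
      have h3 : u / 2 < u := by linarith
      refine ⟨(u - u / 2)⁻¹ * a (u / 2) 0 u + (u / 2 - 0)⁻¹ * (a (u / 2) 0 u - 1),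
        (u - u / 2)⁻¹ * (c (u / 2) 0 u - 1) + (u / 2 - 0)⁻¹ * c (u / 2) 0 u, ?_⟩
      intro s hs hsu
      have := H3 0 s (u / 2) u le_rfl hs hsu h2 h3
      rw [hac s 0 u le_rfl hs hsu, hac (u / 2) 0 u le_rfl h2 h3, St, St, D.pt_inj hi] at this
      rw [← this.1, ← this.2]
      have e1 : u - s ≠ 0 := by linarith
      have e2 : s ≠ 0 := by linarith
      rw [sub_zero]
      constructor
      · field_simp; ring
      · field_simp; ring
    have st0' : ∀ u : ℝ, ∃ g k : ℝ, 0 < u → ∀ s, 0 < s → s < u →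
        u * a s 0 u = (u - s) * (1 + g * s) ∧ u * c s 0 u = s * (1 + k * (u - s)) := by
      intro u
      by_cases hu : 0 < u
      · obtain ⟨g, k, h⟩ := st0 u hu
        exact ⟨g, k, fun _ => h⟩
      · exact ⟨0, 0, fun h => absurd h hu⟩
    choose g k hgk using st0'
    have fa : ∀ s u : ℝ, 0 < s → s < u → a s 0 u = (u - s) * (1 + g u * s) / u := by
      intro s u hs hsu
      have hu := (hs.trans hsu).ne'
      rw [eq_div_iff hu, ← (hgk u (hs.trans hsu) s hs hsu).1, mul_comm]
    have fc : ∀ s u : ℝ, 0 < s → s < u → c s 0 u = s * (1 + k u * (u - s)) / u := by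
      intro s u hs hsu
      have hu := (hs.trans hsu).ne'
      rw [eq_div_iff hu, ← (hgk u (hs.trans hsu) s hs hsu).2, mul_comm]
    have fl : ∀ s t u : ℝ, 0 < s → s < t → t < u →
        a s 0 t + c s 0 t * a t 0 u = a s 0 u ∧ c s 0 t * c t 0 u = c s 0 u := by
      intro s t u h1 h2 h3
      have := (H2 0 s t u le_rfl h1 h2 h3).2
      rwa [hac t 0 u le_rfl (h1.trans h2) h3, hac s 0 t le_rfl h1 h2,
        hac s 0 u le_rfl h1 (h2.trans h3), D.lm_pt, D.pt_inj hi] at this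
    have fr : ∀ s t u : ℝ, 0 < s → s < t → t < u →
        a t s u * a s 0 u = a t 0 u ∧ a t s u * c s 0 u + c t s u = c t 0 u := by
      intro s t u h1 h2 h3
      have := (H2 0 s t u le_rfl h1 h2 h3).1
      rwa [hac s 0 u le_rfl h1 (h2.trans h3), hac t s u h1.le h2 h3,
        hac t 0 u le_rfl (h1.trans h2) h3, D.rm_pt, D.pt_inj hi] at this
    -- the recursion for `k`
    have k2 : ∀ t u : ℝ, 0 < t → t < u → k t * (1 + k u * (u - t)) = k u := by
      intro t u ht htu
      have h := (fl (t / 2) t u (by linarith) (by linarith) htu).2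
      rw [fc _ _ (by linarith) (by linarith), fc _ _ ht htu,
        fc _ _ (by linarith) (by linarith)] at h
      have hu : u ≠ 0 := by linarith
      have ht' : t ≠ 0 := by linarith
      field_simp at h
      have h' : t * (k t * (1 + k u * (u - t)) - k u) = 0 := by linear_combination h
      rcases mul_eq_zero.1 h' with h | h
      · exact absurd h ht'
      · linarith
    have g2 : ∀ t u : ℝ, 0 < t → t < u →
        u * g t + (u - t) * k t * (1 + g u * t) = g u * t := by
      intro t u ht htu
      have h := (fl (t / 2) t u (by linarith) (by linarith) htu).1
      rw [fa _ _ (by linarith) (by linarith), fc _ _ (by linarith) (by linarith), fa _ _ ht htu,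
        fa _ _ (by linarith) (by linarith)] at h
      have hu : u ≠ 0 := by linarith
      have ht' : t ≠ 0 := by linarith
      field_simp at h
      have h' : t * (u * g t + (u - t) * k t * (1 + g u * t) - g u * t) = 0 := by
        linear_combination h
      rcases mul_eq_zero.1 h' with h | h
      · exact absurd h ht'
      · linarith
    obtain ⟨ρ, hρ⟩ : ∃ ρ, k 1 = -ρ := ⟨-k 1, by ring⟩
    obtain ⟨α, hα⟩ : ∃ α, g 1 = α + ρ := ⟨g 1 - ρ, by ring⟩
    have kb : ∀ t : ℝ, 0 < t → k t * (1 - ρ + ρ * t) = -ρ := by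
      intro t ht
      rcases lt_trichotomy t 1 with h | h | h
      · have := k2 t 1 ht h
        rw [hρ] at this; linear_combination this
      · subst h; rw [hρ]; ring
      · have := k2 1 t one_pos h
        rw [hρ] at this; linear_combination -this
    have b0 : ∀ t : ℝ, 0 < t → 1 - ρ + ρ * t ≠ 0 := by
      intro t ht h
      have h1 := kb t ht
      rw [h, mul_zero] at h1
      have : ρ = 0 := by linarith
      subst this
      norm_num at h
    have gb : ∀ t : ℝ, 0 < t → g t * (1 - ρ + ρ * t) = α * t + ρ := by
      intro t ht
      have gen : ∀ t u : ℝ, 0 < t → t < u → u * (g t * (1 - ρ + ρ * t)) - ρ * u =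
          t * (g u * (1 - ρ + ρ * u)) - ρ * t := by
        intro t u ht htu
        linear_combination (1 - ρ + ρ * t) * g2 t u ht htu - (u - t) * (1 + g u * t) * kb t ht
      rcases lt_trichotomy t 1 with h | h | h
      · have := gen t 1 ht h
        rw [hα] at this; linear_combination this
      · subst h; rw [hα]; ring
      · have := gen 1 t one_pos h
        rw [hα] at this; linear_combination -this
    obtain ⟨r0, r1⟩ := rho_range ρ b0
    have ga : ∀ s u : ℝ, 0 < s → s < u → (1 + g u * s) * (1 - ρ + ρ * u) =
        α * s * u + ρ * (s + u) + 1 - ρ := by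
      intro s u hs hsu
      linear_combination s * gb u (hs.trans hsu)
    have gc : ∀ s u : ℝ, 0 < s → s < u → (1 + k u * (u - s)) * (1 - ρ + ρ * u) =
        1 - ρ + ρ * s := by
      intro s u hs hsu
      linear_combination (u - s) * kb u (hs.trans hsu)
    have fa' : ∀ s u : ℝ, 0 < s → s < u → a s 0 u = (u - s) *
        (α * s * u + ρ * (s + u) + 1 - ρ) / (u * (1 - ρ + ρ * u)) := by
      intro s u hs hsu
      have e1 := b0 u (hs.trans hsu)
      have e2 : u ≠ 0 := by linarith
      rw [fa s u hs hsu, ← ga s u hs hsu, ← mul_assoc, mul_div_mul_right _ _ e1]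
    have fc' : ∀ s u : ℝ, 0 < s → s < u → c s 0 u = s *
        (1 - ρ + ρ * s) / (u * (1 - ρ + ρ * u)) := by
      intro s u hs hsu
      have e1 := b0 u (hs.trans hsu)
      have e2 : u ≠ 0 := by linarith
      rw [fc s u hs hsu, ← gc s u hs hsu, ← mul_assoc, mul_div_mul_right _ _ e1]
    have al : 0 ≤ α := by
      apply alpha_range ρ α
      intro s u hs hsu h
      apply (na 0 s u le_rfl hs hsu).1
      rw [fa' s u hs hsu, h]; simp
    refine ⟨ρ, α, ⟨r0, r1⟩, al, ?_⟩
    intro r s u hr hrs hsu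
    rw [hac s r u hr hrs hsu, D.pt_inj hi]
    have hu : 0 < u := by linarith
    rcases hr.eq_or_lt with h | h
    · subst h
      rw [fa' s u hrs hsu, fc' s u hrs hsu]
      constructor <;> congr 1 <;> ring
    · obtain ⟨p, q⟩ := fr r s u h hrs hsu
      have hru := hrs.trans hsu
      have bru := (b_pos ρ α r u r0 r1 al hr hu).ne'
      have e1 := b0 u hu
      have e2 : u - r ≠ 0 := by linarith
      have e3 := hu.ne'
      rw [fa' r u h hru, fa' s u (h.trans hrs) hsu] at p
      rw [fc' r u h hru, fc' s u (h.trans hrs) hsu] at q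
      have p' : a s r u = (u - s) * (α * s * u + ρ * (s + u) + 1 - ρ) /
                ((u - r) * (α * r * u + ρ * (r + u) + 1 - ρ)) := by
        rw [eq_div_iff (mul_ne_zero e2 bru)]
        have e4 := mul_ne_zero e3 e1
        rw [← mul_div_assoc, div_left_inj' e4] at p
        exact p
      refine ⟨p', ?_⟩
      rw [← sub_eq_iff_eq_add'.2 q.symm, p']
      generalize hb : α * r * u + ρ * (r + u) + 1 - ρ = b at *
      field_simp
      rw [← hb]
      ring
  · rintro ⟨ρ, α, ⟨r0, r1⟩, al, H⟩
    have bp : ∀ r u : ℝ, 0 ≤ r → r < u → α * r * u + ρ * (r + u) + 1 - ρ ≠ 0 := by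
      intro r u hr hu
      exact (b_pos ρ α r u r0 r1 al hr (by linarith)).ne'
    refine ⟨?_, ?_, ?_⟩
    · intro r s u hr hrs hsu
      rw [H r s u hr hrs hsu]
      have e0 := bp r u hr (by linarith)
      have e1 := bp r s hr hrs
      have e2 := bp s u (by linarith) hsu
      have e3 : u - r ≠ 0 := by linarith
      have e4 : u - s ≠ 0 := by linarith
      have e5 : s - r ≠ 0 := by linarith
      exact ⟨⟨_, (D.linv_iff hi _ _ _).2 ⟨div_ne_zero (mul_ne_zero e5 e1) (mul_ne_zero e3 e0), rfl⟩⟩,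
        ⟨_, (D.rinv_iff hi _ _ _).2 ⟨div_ne_zero (mul_ne_zero e4 e2) (mul_ne_zero e3 e0), rfl⟩⟩⟩
    · intro r s t u hr hrs hst htu
      rw [H r s u hr hrs (by linarith), H s t u (by linarith) hst htu,
        H r t u hr (by linarith) htu, H r s t hr hrs hst, D.rm_pt, D.lm_pt, D.pt_inj hi,
        D.pt_inj hi]
      have e0 := bp r u hr (by linarith)
      have e1 := bp r t hr (by linarith)
      have e2 := bp s u (by linarith) (by linarith)
      have e3 : u - r ≠ 0 := by linarith
      have e4 : u - s ≠ 0 := by linarith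
      have e5 : t - r ≠ 0 := by linarith
      generalize h0 : α * r * u + ρ * (r + u) + 1 - ρ = b0 at *
      generalize h1 : α * r * t + ρ * (r + t) + 1 - ρ = b1 at *
      generalize h2 : α * s * u + ρ * (s + u) + 1 - ρ = b2 at *
      refine ⟨⟨?_, ?_⟩, ?_, ?_⟩
      · field_simp
      · field_simp
        subst h0 h1 h2; ring
      · field_simp
        subst h0 h1 h2; ring
      · field_simp
    · have key : ∀ r s u : ℝ, 0 ≤ r → r < s → s < u →
          (u - s)⁻¹ • (x s r u - D.el) + (s - r)⁻¹ • (x s r u - D.er) =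
          D.pt ((α * u + ρ) / (α * r * u + ρ * (r + u) + 1 - ρ))
            (-(α * r + ρ) / (α * r * u + ρ * (r + u) + 1 - ρ)) := by
        intro r s u hr hrs hsu
        rw [H r s u hr hrs hsu, St, D.pt_inj hi]
        have e0 := bp r u hr (by linarith)
        have e3 : u - r ≠ 0 := by linarith
        have e4 : u - s ≠ 0 := by linarith
        have e5 : s - r ≠ 0 := by linarith
        generalize h0 : α * r * u + ρ * (r + u) + 1 - ρ = b0 at *
        constructor
        · field_simp
          subst h0; ring
        · field_simp
          subst h0; ring
      intro r s s' u hr h1 h2 h3 h4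
      rw [key r s u hr h1 h2, key r s' u hr h3 h4]

/-- For linearly independent identities `e_⋉, e_⋊`: (1) `h = β•e_⋊ + γ•e_⋉` is a flow
generator iff `γ ∈ [−1,0]` and `β + γ ≥ 0`; (2) a family with values in
`span{e_⋊, e_⋉}` is a two-way flow iff there are `ρ ∈ [0,1]` and `α ≥ 0` with
`x s r u = ((u−s)b(s,u)/((u−r)b(r,u)))•e_⋊ + ((s−r)b(r,s)/((u−r)b(r,u)))•e_⋉`,
where `b(s,u) = αsu + ρ(s+u) + 1 − ρ`. -/
theorem stmt12 (D : DNA W)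
    (hindep : LinearIndependent ℝ ![D.el, D.er]) :
    (∀ β γ : ℝ, D.IsFlowGenerator (β • D.er + γ • D.el) ↔
      (γ ∈ Set.Icc (-1 : ℝ) 0 ∧ 0 ≤ β + γ)) ∧
    (∀ x : ℝ → ℝ → ℝ → W,
      (∀ r s u : ℝ, 0 ≤ r → r < s → s < u →
        x s r u ∈ Submodule.span ℝ ({D.er, D.el} : Set W)) →
      (D.IsTwoWayFlow x ↔
        ∃ ρ α : ℝ, ρ ∈ Set.Icc (0 : ℝ) 1 ∧ 0 ≤ α ∧
          ∀ r s u : ℝ, 0 ≤ r → r < s → s < u →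
            x s r u =
              ((u - s) * (α * s * u + ρ * (s + u) + 1 - ρ) /
                ((u - r) * (α * r * u + ρ * (r + u) + 1 - ρ))) • D.er +
              ((s - r) * (α * r * s + ρ * (r + s) + 1 - ρ) /
                ((u - r) * (α * r * u + ρ * (r + u) + 1 - ρ))) • D.el)) := by
  exact ⟨D.gen_iff hindep, D.flow_iff hindep⟩
end

section
/- In the double near algebra Q on ℝ⁶ × ℝ², a family x_{sru} = (x⁽¹⁾_{sru},…,x⁽⁶⁾_{sru}; (u−s)/(u−r), (s−r)/(u−r)), 0 ≤ r < s < u, is a two-way flow if and only if there exist α ≥ 0, ρ ∈ [0,1], β ≥ −2√(α(1−ρ)), and h₄, h₅, h₆ ∈ ℝ such that, with c(s,u) := αsu + (β−ρ)s + ρu + 1 − ρ, for all 0 ≤ r < s < u: x⁽¹⁾_{sru} = (u−s)c(s,u)/((u−r)c(r,u)), x⁽²⁾_{sru} = (s−r)(u−s)(2ρ−β)/((u−r)c(r,u)), x⁽³⁾_{sru} = (s−r)c(r,s)/((u−r)c(r,u)), x⁽⁴⁾_{sru} = (u−s)(s−r)(h₄u − h₅(1−u))/((u−r)c(r,u)),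 x⁽⁵⁾_{sru} = (u−s)(s−r)(h₅(1−r) − h₄r)/((u−r)c(r,u)), x⁽⁶⁾_{sru} = (u−s)(s−r)h₆/c(r,u). -/
/-- The carrier `ℝ⁶ × ℝ²` of the double near algebra `Q`. -/
abbrev QDNA : Type := (Fin 6 → ℝ) × (Fin 2 → ℝ)

/-- The multiplication ⋊ of `Q`. -/
def qrm (a b : QDNA) : QDNA :=
  (![a.1 0 * b.1 0,
     a.1 1 * b.1 0 + a.2 0 * b.1 1,
     a.1 2 * b.1 0 + a.2 1 * b.1 1 + b.1 2,
     a.1 3 * b.1 0 + a.2 0 * b.1 3,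
     a.1 4 * b.1 0 + a.2 1 * b.1 3 + b.1 4,
     a.1 5 * b.1 0 + b.1 5],
   ![a.2 0 * b.2 0, a.2 1 * b.2 0 + b.2 1])

/-- The multiplication ⋉ of `Q`. -/
def qlm (a b : QDNA) : QDNA :=
  (![b.1 0 + a.2 0 * b.1 1 + a.1 0 * b.1 2,
     a.2 1 * b.1 1 + a.1 1 * b.1 2,
     a.1 2 * b.1 2,
     a.1 3 * b.1 2 + b.1 3 + a.2 0 * b.1 4,
     a.1 4 * b.1 2 + a.2 1 * b.1 4,
     a.1 5 * b.1 2 + b.1 5],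
   ![b.2 0 + a.2 0 * b.2 1, a.2 1 * b.2 1])

/-- The identity `e_⋉ = (0,0,1,0,0,0;0,1)` of `Q`. -/
def qel : QDNA := (![0, 0, 1, 0, 0, 0], ![0, 1])

/-- The identity `e_⋊ = (1,0,0,0,0,0;1,0)` of `Q`. -/
def qer : QDNA := (![1, 0, 0, 0, 0, 0], ![1, 0])

/-- `c(s,u) = αsu + (β−ρ)s + ρu + 1 − ρ`. -/
def cQ (α β ρ s u : ℝ) : ℝ := α * s * u + (β - ρ) * s + ρ * u + 1 - ρ


lemma aux_struct (X : ℝ → ℝ → ℝ → ℝ) (l e : ℝ)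
    (h : ∀ r s s' u : ℝ, 0 ≤ r → r < s → s < u → r < s' → s' < u →
    (u - s)⁻¹ * (X s r u - l) + (s - r)⁻¹ * (X s r u - e) =
    (u - s')⁻¹ * (X s' r u - l) + (s' - r)⁻¹ * (X s' r u - e)) :
    ∃ B : ℝ → ℝ → ℝ, ∀ r s u : ℝ, 0 ≤ r → r < s → s < u →
      X s r u = ((s - r) * l + (u - s) * e + (u - s) * (s - r) * B r u) / (u - r) := by
  refine ⟨fun r u => (u - (r+u)/2)⁻¹ * (X ((r+u)/2) r u - l) +
    ((r+u)/2 - r)⁻¹ * (X ((r+u)/2) r u - e), fun r s u hr hs hu => ?_⟩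
  have := h r s ((r+u)/2) u hr hs hu (by linarith) (by linarith)
  simp only [← this]
  have h1 : u - s ≠ 0 := by linarith
  have h2 : s - r ≠ 0 := by linarith
  have h3 : u - r ≠ 0 := by linarith
  field_simp
  ring

/-- relation from a cocycle for the first product -/
lemma aux_R1 (r s t u b b' : ℝ) (h1 : r < s) (h2 : s < t) (h3 : t < u)
    (h : ((s - r) * 0 + (u - s) * 1 + (u - s) * (s - r) * b) / (u - r) *
      (((t - s) * 0 + (u - t) * 1 + (u - t) * (t - s) * b') / (u - s)) =
      ((t - r) * 0 + (u - t) * 1 + (u - t) * (t - r) * b) / (u - r)) :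
    b' * (1 + (s - r) * b) = b := by
  have k1 : u - s ≠ 0 := by linarith
  have k2 : u - r ≠ 0 := by linarith
  have k3 : (u - t) * (t - s) * (u - s) ≠ 0 :=
    mul_ne_zero (mul_ne_zero (by linarith) (by linarith)) k1
  field_simp at h
  apply mul_left_cancel₀ k3
  linear_combination h

lemma aux_L3 (r s t u a a' : ℝ) (h1 : r < s) (h2 : s < t) (h3 : t < u)
    (h : ((t - r) * 1 + (u - t) * 0 + (u - t) * (t - r) * a) / (u - r) *
      (((s - r) * 1 + (t - s) * 0 + (t - s) * (s - r) * a') / (t - r)) =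
      ((s - r) * 1 + (u - s) * 0 + (u - s) * (s - r) * a) / (u - r)) :
    a' * (1 + (u - t) * a) = a := by
  have k1 : t - r ≠ 0 := by linarith
  have k2 : u - r ≠ 0 := by linarith
  have k3 : (t - s) * (s - r) * (t - r) ≠ 0 :=
    mul_ne_zero (mul_ne_zero (by linarith) (by linarith)) k1
  field_simp at h
  apply mul_left_cancel₀ k3
  linear_combination h

lemma aux_R2 (r s t u b b' D D' : ℝ) (h1 : r < s) (h2 : s < t) (h3 : t < u)
    (hb : b' * (1 + (s - r) * b) = b)
    (h : ((s - r) * 0 + (u - s) * 0 + (u - s) * (s - r) * D) / (u - r) *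
      (((t - s) * 0 + (u - t) * 1 + (u - t) * (t - s) * b') / (u - s)) +
      (u - s) / (u - r) * (((t - s) * 0 + (u - t) * 0 + (u - t) * (t - s) * D') / (u - s)) =
      ((t - r) * 0 + (u - t) * 0 + (u - t) * (t - r) * D) / (u - r)) :
    D' * (1 + (s - r) * b) = D := by
  have k1 : u - s ≠ 0 := by linarith
  have k2 : u - r ≠ 0 := by linarith
  have k3 : (u - t) * (t - s) * (u - s) ≠ 0 :=
    mul_ne_zero (mul_ne_zero (by linarith) (by linarith)) k1
  have e : (s - r) * D * b' + D' = D := by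
    field_simp at h
    apply mul_left_cancel₀ k3
    linear_combination h
  linear_combination (1 + (s - r) * b) * e - (s - r) * D * hb

lemma aux_L2 (r s t u a a' D D' : ℝ) (h1 : r < s) (h2 : s < t) (h3 : t < u)
    (ha : a' * (1 + (u - t) * a) = a)
    (h : (t - r) / (u - r) * (((s - r) * 0 + (t - s) * 0 + (t - s) * (s - r) * D') / (t - r)) +
      ((t - r) * 0 + (u - t) * 0 + (u - t) * (t - r) * D) / (u - r) *
      (((s - r) * 1 + (t - s) * 0 + (t - s) * (s - r) * a') / (t - r)) =
      ((s - r) * 0 + (u - s) * 0 + (u - s) * (s - r) * D) / (u - r)) :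
    D' * (1 + (u - t) * a) = D := by
  have k1 : t - r ≠ 0 := by linarith
  have k2 : u - r ≠ 0 := by linarith
  have k3 : (t - s) * (s - r) * (t - r) ≠ 0 :=
    mul_ne_zero (mul_ne_zero (by linarith) (by linarith)) k1
  have e : (u - t) * D * a' + D' = D := by
    field_simp at h
    apply mul_left_cancel₀ k3
    linear_combination h
  linear_combination (1 + (u - t) * a) * e - (u - t) * D * ha

lemma aux_R6 (r s t u b b' D D' : ℝ) (h1 : r < s) (h2 : s < t) (h3 : t < u)
    (hb : b' * (1 + (s - r) * b) = b)
    (h : ((s - r) * 0 + (u - s) * 0 + (u - s) * (s - r) * D) / (u - r) *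
      (((t - s) * 0 + (u - t) * 1 + (u - t) * (t - s) * b') / (u - s)) +
      (((t - s) * 0 + (u - t) * 0 + (u - t) * (t - s) * D') / (u - s)) =
      ((t - r) * 0 + (u - t) * 0 + (u - t) * (t - r) * D) / (u - r)) :
    D' / (u - s) * (1 + (s - r) * b) = D / (u - r) := by
  have k1 : u - s ≠ 0 := by linarith
  have k2 : u - r ≠ 0 := by linarith
  refine aux_R2 r s t u b b' _ _ h1 h2 h3 hb ?_
  field_simp at h ⊢
  linear_combination h

lemma aux_L6 (r s t u a a' D D' : ℝ) (h1 : r < s) (h2 : s < t) (h3 : t < u)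
    (ha : a' * (1 + (u - t) * a) = a)
    (h : ((t - r) * 0 + (u - t) * 0 + (u - t) * (t - r) * D) / (u - r) *
      (((s - r) * 1 + (t - s) * 0 + (t - s) * (s - r) * a') / (t - r)) +
      (((s - r) * 0 + (t - s) * 0 + (t - s) * (s - r) * D') / (t - r)) =
      ((s - r) * 0 + (u - s) * 0 + (u - s) * (s - r) * D) / (u - r)) :
    D' / (t - r) * (1 + (u - t) * a) = D / (u - r) := by
  have k1 : t - r ≠ 0 := by linarith
  have k2 : u - r ≠ 0 := by linarith
  refine aux_L2 r s t u a a' _ _ h1 h2 h3 ha ?_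
  field_simp at h ⊢
  linear_combination h

lemma aux_R3 (r s t u a a' b b' D D' : ℝ) (h1 : r < s) (h2 : s < t) (h3 : t < u)
    (hb : b' * (1 + (s - r) * b) = b) (hD : D' * (1 + (s - r) * b) = D)
    (h : ((s - r) * 1 + (u - s) * 0 + (u - s) * (s - r) * a) / (u - r) *
      (((t - s) * 0 + (u - t) * 1 + (u - t) * (t - s) * b') / (u - s)) +
      (s - r) / (u - r) * (((t - s) * 0 + (u - t) * 0 + (u - t) * (t - s) * D') / (u - s)) +
      ((t - s) * 1 + (u - t) * 0 + (u - t) * (t - s) * a') / (u - s) =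
      ((t - r) * 1 + (u - t) * 0 + (u - t) * (t - r) * a) / (u - r)) :
    (u - r) * (a' * (1 + (s - r) * b)) = (u - s) * a - (s - r) * (b + D) := by
  have k1 : u - s ≠ 0 := by linarith
  have k2 : u - r ≠ 0 := by linarith
  have k3 : (u - t) * (t - s) ≠ 0 := mul_ne_zero (by linarith) (by linarith)
  have e : -(u - s) * a + (s - r) * b' + (s - r) * (u - s) * a * b' + (s - r) * D'
      + (u - r) * a' = 0 := by
    field_simp at h
    apply mul_left_cancel₀ k3
    linear_combination h
  linear_combination (1 + (s - r) * b) * e - (s - r) * (1 + (u - s) * a) * hb - (s - r) * hD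

lemma aux_L1 (r s t u a a' b b' D D' : ℝ) (h1 : r < s) (h2 : s < t) (h3 : t < u)
    (ha : a' * (1 + (u - t) * a) = a) (hD : D' * (1 + (u - t) * a) = D)
    (h : ((s - r) * 0 + (t - s) * 1 + (t - s) * (s - r) * b') / (t - r) +
      (u - t) / (u - r) * (((s - r) * 0 + (t - s) * 0 + (t - s) * (s - r) * D') / (t - r)) +
      ((t - r) * 0 + (u - t) * 1 + (u - t) * (t - r) * b) / (u - r) *
      (((s - r) * 1 + (t - s) * 0 + (t - s) * (s - r) * a') / (t - r)) =
      ((s - r) * 0 + (u - s) * 1 + (u - s) * (s - r) * b) / (u - r)) :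
    (u - r) * (b' * (1 + (u - t) * a)) = (t - r) * b - (u - t) * (a + D) := by
  have k1 : t - r ≠ 0 := by linarith
  have k2 : u - r ≠ 0 := by linarith
  have k3 : (t - s) * (s - r) ≠ 0 := mul_ne_zero (by linarith) (by linarith)
  have e : -(t - r) * b + (u - t) * a' + (t - r) * (u - t) * b * a' + (u - t) * D'
      + (u - r) * b' = 0 := by
    field_simp at h
    apply mul_left_cancel₀ k3
    linear_combination h
  linear_combination (1 + (u - t) * a) * e - (u - t) * (1 + (t - r) * b) * ha - (u - t) * hD

lemma aux_R5 (r s t u b b' E E' F F' : ℝ) (h1 : r < s) (h2 : s < t) (h3 : t < u)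
    (hb : b' * (1 + (s - r) * b) = b) (hE : E' * (1 + (s - r) * b) = E)
    (h : ((s - r) * 0 + (u - s) * 0 + (u - s) * (s - r) * F) / (u - r) *
      (((t - s) * 0 + (u - t) * 1 + (u - t) * (t - s) * b') / (u - s)) +
      (s - r) / (u - r) * (((t - s) * 0 + (u - t) * 0 + (u - t) * (t - s) * E') / (u - s)) +
      ((t - s) * 0 + (u - t) * 0 + (u - t) * (t - s) * F') / (u - s) =
      ((t - r) * 0 + (u - t) * 0 + (u - t) * (t - r) * F) / (u - r)) :
    (s - r) * E + (u - r) * (F' * (1 + (s - r) * b)) = (u - s) * F := by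
  have k1 : u - s ≠ 0 := by linarith
  have k2 : u - r ≠ 0 := by linarith
  have k3 : (u - t) * (t - s) ≠ 0 := mul_ne_zero (by linarith) (by linarith)
  have e : (s - r) * (u - s) * F * b' + (s - r) * E' + (u - r) * F' = (u - s) * F := by
    field_simp at h
    apply mul_left_cancel₀ k3
    linear_combination h
  linear_combination (1 + (s - r) * b) * e - (s - r) * (u - s) * F * hb - (s - r) * hE

/-- Positivity of `c` from the parameter constraints. -/
lemma aux_cpos (α ρ β : ℝ) (hα : 0 ≤ α) (hρ : ρ ∈ Set.Icc (0 : ℝ) 1)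
    (hβ : -2 * Real.sqrt (α * (1 - ρ)) ≤ β) (s u : ℝ) (hs : 0 ≤ s) (hu : s < u) :
    0 < cQ α β ρ s u := by
  obtain ⟨h0, h1⟩ := hρ
  have hq : 0 ≤ α * s ^ 2 + β * s + (1 - ρ) := by
    rw [Real.sqrt_mul hα] at hβ
    have e1 := Real.sq_sqrt hα
    have e2 := Real.sq_sqrt (show 0 ≤ 1 - ρ by linarith)
    nlinarith [sq_nonneg (Real.sqrt α * s - Real.sqrt (1 - ρ)), mul_le_mul_of_nonneg_right hβ hs]
  have hc : cQ α β ρ s u = (α * s ^ 2 + β * s + (1 - ρ)) + (u - s) * (α * s + ρ) := by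
    unfold cQ; ring
  have hus : 0 < u - s := by linarith
  have has : 0 ≤ α * s := mul_nonneg hα hs
  rcases h0.lt_or_eq with h | h
  · rw [hc]; have := mul_pos hus (show 0 < α * s + ρ by linarith); linarith
  · subst h
    rcases has.lt_or_eq with h | h
    · rw [hc]; have := mul_pos hus (show 0 < α * s + 0 by linarith); linarith
    · rcases mul_eq_zero.1 h.symm with h | h
      · subst h
        simp at hβ
        unfold cQ
        nlinarith [mul_nonneg hβ hs]
      · subst h; unfold cQ; norm_num

/-- Parameter constraints from nonvanishing of `c`. -/
lemma aux_params (α ρ β : ℝ) (hc : ∀ s u : ℝ, 0 ≤ s → s < u → cQ α β ρ s u ≠ 0) :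
    0 ≤ α ∧ ρ ∈ Set.Icc (0 : ℝ) 1 ∧ -2 * Real.sqrt (α * (1 - ρ)) ≤ β := by
  have hρ : ρ ∈ Set.Icc (0 : ℝ) 1 := by
    by_contra hn
    have hr : 0 < (ρ - 1) / ρ := by
      by_cases h : 0 ≤ ρ
      · have : 1 < ρ := by by_contra h'; exact hn ⟨h, by linarith⟩
        exact div_pos (by linarith) (by linarith)
      · exact div_pos_of_neg_of_neg (by linarith) (by linarith)
    have h0 : ρ ≠ 0 := by rintro rfl; simp at hr
    apply hc 0 _ le_rfl hr
    unfold cQ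
    field_simp
    ring
  obtain ⟨h0, h1⟩ := hρ
  have hpos : ∀ s u : ℝ, 0 ≤ s → s < u → 0 < cQ α β ρ s u := by
    intro s u hs hu
    by_contra hn
    have hlt : cQ α β ρ s u < 0 := lt_of_le_of_ne (not_lt.1 hn) (hc s u hs hu)
    have h0u : 0 < cQ α β ρ 0 u := by
      refine lt_of_le_of_ne ?_ (hc 0 u le_rfl (by linarith)).symm
      unfold cQ
      nlinarith [mul_nonneg h0 (show 0 ≤ u by linarith)]
    have hlin : ∀ k : ℝ, cQ α β ρ (s * k) u =
        cQ α β ρ 0 u + k * (cQ α β ρ s u - cQ α β ρ 0 u) := by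
      intro k; unfold cQ; ring
    set p := cQ α β ρ 0 u with hp
    set q := cQ α β ρ s u with hq
    have hpq : 0 < p - q := by linarith
    have hf1 : p / (p - q) ≤ 1 := by rw [div_le_one hpq]; linarith
    have hf0 : 0 ≤ p / (p - q) := by positivity
    apply hc (s * (p / (p - q))) u (by positivity) (by nlinarith)
    rw [hlin]
    field_simp
    ring
  have hq : ∀ s : ℝ, 0 ≤ s → 0 ≤ α * s ^ 2 + β * s + (1 - ρ) := by
    intro s hs
    by_contra hn
    push Not at hn
    set q := α * s ^ 2 + β * s + (1 - ρ) with hqd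
    set k := |α * s + ρ| + 1
    have hk : 0 < k := by positivity
    have hk' : α * s + ρ ≤ k := by have := le_abs_self (α * s + ρ); linarith
    have := hpos s (s + (-q) / k) hs (by have : 0 < (-q) / k := div_pos (by linarith) hk
                                         linarith)
    have e : cQ α β ρ s (s + (-q) / k) = q + (-q) / k * (α * s + ρ) := by
      unfold cQ; rw [hqd]; ring
    rw [e] at this
    have h2 : (-q) / k * (α * s + ρ) ≤ (-q) / k * k :=
      mul_le_mul_of_nonneg_left hk' (div_nonneg (by linarith) hk.le)
    rw [div_mul_cancel₀ _ hk.ne'] at h2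
    linarith
  have hα : 0 ≤ α := by
    by_contra hn
    push Not at hn
    have := hq ((|β| + 2) / (-α) + 1) (by have : 0 ≤ (|β| + 2) / (-α) := div_nonneg (by positivity) (by linarith)
                                          linarith)
    set y := (|β| + 2) / (-α) with hy
    have hy0 : 0 ≤ y := div_nonneg (by positivity) (by linarith)
    have e : α * y = -(|β| + 2) := by rw [hy, div_neg, mul_neg, mul_div_cancel₀ _ hn.ne]
    have e2 : α * (y + 1) ^ 2 + β * (y+1) = (y + 1) * (-(|β| + 2) + α + β) := by
      linear_combination (y + 1) * e
    have := le_abs_self β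
    nlinarith
  refine ⟨hα, ⟨h0, h1⟩, ?_⟩
  rw [Real.sqrt_mul hα]
  have e1 := Real.sq_sqrt hα
  have e2 := Real.sq_sqrt (show 0 ≤ 1 - ρ by linarith)
  have p1 := Real.sqrt_nonneg α
  have p2 := Real.sqrt_nonneg (1 - ρ)
  set p := Real.sqrt α
  set q := Real.sqrt (1 - ρ)
  rw [← e1, ← e2] at hq
  by_contra hn
  push Not at hn
  rcases p1.lt_or_eq with hp | hp
  · -- choose s with p s = q + small
    set δ := -2 * (p * q) - β with hδ
    have hδ' : 0 < δ := by linarith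
    set s := q / p + δ / (2 * p ^ 2) with hs
    have hs0 : 0 < s := by positivity
    have := hq s hs0.le
    have e3 : p * s = q + δ / (2 * p) := by rw [hs]; field_simp
    have e4 : p ^ 2 * s ^ 2 + β * s + q ^ 2 = (p * s - q) ^ 2 - δ * s := by rw [hδ]; ring
    rw [e4, e3] at this
    have e5 : (q + δ / (2 * p) - q) ^ 2 - δ * s = - (δ ^ 2 / (4 * p ^ 2)) - δ * (q / p) := by
      rw [hs]; field_simp; ring
    rw [e5] at this
    have : 0 < δ ^ 2 / (4 * p ^ 2) := by positivity
    have : 0 ≤ δ * (q / p) := by positivity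
    linarith
  · rw [← hp] at hn hq
    have hβ : β < 0 := by linarith
    have := hq ((q ^ 2 + 1) / (-β)) (div_nonneg (by positivity) (by linarith))
    have e : β * ((q ^ 2 + 1) / (-β)) = -(q ^ 2 + 1) := by
      rw [div_neg, mul_neg, mul_div_cancel₀ _ hβ.ne]
    rw [e] at this
    linarith

/-- Forward direction on scalar data. -/
lemma aux_forward (b a D E F H : ℝ → ℝ → ℝ)
    (nb : ∀ r s u : ℝ, 0 ≤ r → r < s → s < u → 1 + (s - r) * b r u ≠ 0)
    (na : ∀ r s u : ℝ, 0 ≤ r → r < s → s < u → 1 + (u - s) * a r u ≠ 0)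
    (R1 : ∀ r s u : ℝ, 0 ≤ r → r < s → s < u → b s u * (1 + (s - r) * b r u) = b r u)
    (L3 : ∀ r s u : ℝ, 0 ≤ r → r < s → s < u → a r s * (1 + (u - s) * a r u) = a r u)
    (R2 : ∀ r s u : ℝ, 0 ≤ r → r < s → s < u → D s u * (1 + (s - r) * b r u) = D r u)
    (L2 : ∀ r s u : ℝ, 0 ≤ r → r < s → s < u → D r s * (1 + (u - s) * a r u) = D r u)
    (R3 : ∀ r s u : ℝ, 0 ≤ r → r < s → s < u →
      (u - r) * (a s u * (1 + (s - r) * b r u)) = (u - s) * a r u - (s - r) * (b r u + D r u))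
    (L1 : ∀ r s u : ℝ, 0 ≤ r → r < s → s < u →
      (u - r) * (b r s * (1 + (u - s) * a r u)) = (s - r) * b r u - (u - s) * (a r u + D r u))
    (R4 : ∀ r s u : ℝ, 0 ≤ r → r < s → s < u → E s u * (1 + (s - r) * b r u) = E r u)
    (L5 : ∀ r s u : ℝ, 0 ≤ r → r < s → s < u → F r s * (1 + (u - s) * a r u) = F r u)
    (R5 : ∀ r s u : ℝ, 0 ≤ r → r < s → s < u →
      (s - r) * E r u + (u - r) * (F s u * (1 + (s - r) * b r u)) = (u - s) * F r u)
    (R6 : ∀ r s u : ℝ, 0 ≤ r → r < s → s < u → H s u * (1 + (s - r) * b r u) = H r u)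
    (L6 : ∀ r s u : ℝ, 0 ≤ r → r < s → s < u → H r s * (1 + (u - s) * a r u) = H r u) :
    ∃ α ρ β h4 h5 h6 : ℝ, ∀ r u : ℝ, 0 ≤ r → r < u →
      cQ α β ρ r u ≠ 0 ∧ b r u * cQ α β ρ r u = α * u + (β - ρ) ∧
      a r u * cQ α β ρ r u = -(ρ + α * r) ∧ D r u * cQ α β ρ r u = 2 * ρ - β ∧
      E r u * cQ α β ρ r u = h4 * u - h5 * (1 - u) ∧
      F r u * cQ α β ρ r u = h5 * (1 - r) - h4 * r ∧ H r u * cQ α β ρ r u = h6 := by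
  obtain ⟨ρ, hρ⟩ : ∃ ρ, ρ = - a 0 1 := ⟨_, rfl⟩
  obtain ⟨β, hβ⟩ : ∃ β, β = 2 * ρ - D 0 1 := ⟨_, rfl⟩
  obtain ⟨α, hα⟩ : ∃ α, α = b 0 1 + ρ - β := ⟨_, rfl⟩
  -- general extension principle in `u` from `u = 1`
  have hc0 : ∀ u : ℝ, 0 < u → 1 - ρ + ρ * u ≠ 0 ∧ a 0 u * (1 - ρ + ρ * u) = -ρ := by
    intro u hu
    rcases lt_trichotomy u 1 with h | h | h
    · have h1 := na 0 u 1 le_rfl hu h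
      have h2 := L3 0 u 1 le_rfl hu h
      have e : 1 + (1 - u) * a 0 1 = 1 - ρ + ρ * u := by rw [hρ]; ring
      rw [e] at h1 h2
      exact ⟨h1, by rw [h2, hρ]; ring⟩
    · subst h; exact ⟨by norm_num, by rw [hρ]; ring⟩
    · have h2 := L3 0 1 u le_rfl one_pos h
      have e : a 0 u * (1 - ρ + ρ * u) = -ρ := by rw [hρ]; linear_combination -h2
      refine ⟨fun h0 => ?_, e⟩
      rw [h0] at e
      have : ρ = 0 := by linarith
      rw [this] at h0
      norm_num at h0
  -- transport in u
  have hg : ∀ (K : ℝ → ℝ), (∀ s u : ℝ, 0 < s → s < u → K s * (1 + (u - s) * a 0 u) = K u) →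
      ∀ u : ℝ, 0 < u → K u * (1 - ρ + ρ * u) = K 1 := by
    intro K hK u hu
    rcases lt_trichotomy u 1 with h | h | h
    · have h2 := hK u 1 hu h
      rw [← h2, hρ]; ring
    · subst h; ring
    · have h2 := hK 1 u one_pos h
      obtain ⟨h3, h4⟩ := hc0 u hu
      rw [← h2]
      linear_combination K 1 * (u - 1) * h4
  have hgg : ∀ s u : ℝ, 0 < s → s < u →
      (1 + (u - s) * a 0 u) * (1 - ρ + ρ * u) = 1 - ρ + ρ * s := by
    intro s u hs hu
    linear_combination (u - s) * (hc0 u (by linarith)).2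
  have hD0 : ∀ u : ℝ, 0 < u → D 0 u * (1 - ρ + ρ * u) = 2 * ρ - β := by
    intro u hu
    rw [hg (D 0) (fun s u hs hu => L2 0 s u le_rfl hs hu) u hu, hβ]; ring
  have hF0 : ∀ u : ℝ, 0 < u → F 0 u * (1 - ρ + ρ * u) = F 0 1 := 
    hg (F 0) (fun s u hs hu => L5 0 s u le_rfl hs hu)
  have hH0 : ∀ u : ℝ, 0 < u → H 0 u * (1 - ρ + ρ * u) = H 0 1 := 
    hg (H 0) (fun s u hs hu => L6 0 s u le_rfl hs hu)
  have hb' : ∀ s u : ℝ, 0 < s → s < u → u * (b 0 s * (1 - ρ + ρ * s)) =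
      s * (b 0 u * (1 - ρ + ρ * u)) + (u - s) * (β - ρ) := by
    intro s u hs hu
    have h1 := L1 0 s u le_rfl hs hu
    have h2 := hgg s u hs hu
    have h3 := (hc0 u (by linarith)).2
    have h4 := hD0 u (by linarith)
    linear_combination (1 - ρ + ρ * u) * h1 - u * b 0 s * h2 - (u - s) * (h3 + h4)
  have hb0 : ∀ u : ℝ, 0 < u → b 0 u * (1 - ρ + ρ * u) = α * u + (β - ρ) := by
    intro u hu
    rcases lt_trichotomy u 1 with h | h | h
    · have := hb' u 1 hu h
      rw [hα]; linear_combination this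
    · subst h; rw [hα]; ring
    · have := hb' 1 u one_pos h
      rw [hα]; linear_combination -this
  have hf : ∀ s u : ℝ, 0 < s → s < u →
      (1 + (s - 0) * b 0 u) * (1 - ρ + ρ * u) = cQ α β ρ s u := by
    intro s u hs hu
    unfold cQ
    linear_combination s * hb0 u (by linarith)
  have hcne : ∀ s u : ℝ, 0 < s → s < u → cQ α β ρ s u ≠ 0 := by
    intro s u hs hu
    rw [← hf s u hs hu]
    exact mul_ne_zero (nb 0 s u le_rfl hs hu) (hc0 u (by linarith)).1
  have htr : ∀ (K : ℝ → ℝ → ℝ) (s u : ℝ), 0 < s → s < u →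
      K s u * (1 + (s - 0) * b 0 u) = K 0 u →
      K s u * cQ α β ρ s u = K 0 u * (1 - ρ + ρ * u) := by
    intro K s u hs hu h
    rw [← hf s u hs hu]
    linear_combination (1 - ρ + ρ * u) * h
  have hF' : ∀ s u : ℝ, 0 < s → s < u →
      s * (E 0 u * (1 - ρ + ρ * u)) + u * (F s u * cQ α β ρ s u) = (u - s) * F 0 1 := by
    intro s u hs hu
    rw [← hf s u hs hu, ← hF0 u (by linarith)]
    linear_combination (1 - ρ + ρ * u) * R5 0 s u le_rfl hs hu
  -- F s u * c s u independent of u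
  have hFi : ∀ s t u : ℝ, 0 < s → s < t → t < u →
      F s t * cQ α β ρ s t = F s u * cQ α β ρ s u := by
    intro s t u hs ht hu
    have h1 := L5 s t u hs.le ht hu
    have h2 : u * (a s u * cQ α β ρ s u) = u * (-(ρ + α * s)) := by
      have := R3 0 s u le_rfl hs (by linarith)
      have h3 := (hc0 u (by linarith)).2
      have h4 := hD0 u (by linarith)
      have h5 := hb0 u (by linarith)
      rw [← hf s u hs (by linarith)]
      linear_combination (1 - ρ + ρ * u) * this + (u - s) * h3 - s * (h4 + h5)
    have h2 := mul_left_cancel₀ (by linarith) h2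
    have h3 : cQ α β ρ s t = cQ α β ρ s u - (u - t) * (ρ + α * s) := by unfold cQ; ring
    rw [h3, ← h1]
    linear_combination -F s t * (u - t) * h2
  have hE' : ∀ t u : ℝ, 0 < t → t < u →
      u * (E 0 t * (1 - ρ + ρ * t) + F 0 1) = t * (E 0 u * (1 - ρ + ρ * u) + F 0 1) := by
    intro t u ht hu
    have h1 := hF' (t / 2) t (by linarith) (by linarith)
    have h2 := hF' (t / 2) u (by linarith) (by linarith)
    have h3 := hFi (t / 2) t u (by linarith) (by linarith) hu
    have : t / 2 ≠ 0 := by linarith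
    apply mul_left_cancel₀ this
    rw [h3] at h1
    linear_combination u * h1 - t * h2
  have hE0 : ∀ u : ℝ, 0 < u → E 0 u * (1 - ρ + ρ * u) = E 0 1 * u - F 0 1 * (1 - u) := by
    intro u hu
    rcases lt_trichotomy u 1 with h | h | h
    · have := hE' u 1 hu h
      linear_combination this
    · subst h; ring
    · have := hE' 1 u one_pos h
      linear_combination -this
  refine ⟨α, ρ, β, E 0 1, F 0 1, H 0 1, fun r u hr hu => ?_⟩
  rcases hr.lt_or_eq with hr | hr
  · have hu0 : 0 < u := by linarith
    refine ⟨hcne r u hr hu, ?_, ?_, ?_, ?_, ?_, ?_⟩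
    · rw [htr b r u hr hu (R1 0 r u le_rfl hr hu), hb0 u hu0]
    · have := R3 0 r u le_rfl hr hu
      have h3 := (hc0 u hu0).2
      have h4 := hD0 u hu0
      have h5 := hb0 u hu0
      apply mul_left_cancel₀ hu0.ne'
      rw [← hf r u hr hu]
      linear_combination (1 - ρ + ρ * u) * this + (u - r) * h3 - r * (h4 + h5)
    · rw [htr D r u hr hu (R2 0 r u le_rfl hr hu), hD0 u hu0]
    · rw [htr E r u hr hu (R4 0 r u le_rfl hr hu), hE0 u hu0]
    · apply mul_left_cancel₀ hu0.ne'
      linear_combination hF' r u hr hu - r * hE0 u hu0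
    · rw [htr H r u hr hu (R6 0 r u le_rfl hr hu), hH0 u hu0]
  · subst hr
    have e : cQ α β ρ 0 u = 1 - ρ + ρ * u := by unfold cQ; ring
    rw [e]
    refine ⟨(hc0 u hu).1, hb0 u hu, ?_, hD0 u hu, hE0 u hu, ?_, hH0 u hu⟩
    · rw [(hc0 u hu).2]; ring
    · rw [hF0 u hu]; ring

lemma aux_rinv (a : QDNA) (h1 : a.1 0 ≠ 0) (h2 : a.2 0 ≠ 0) : ∃ y, InvPair qrm qer a y := by
  obtain ⟨x, u⟩ := a
  simp only at h1 h2
  refine ⟨(![1 / x 0, -(x 1) / (x 0 * u 0), -(x 2) / x 0 + u 1 * x 1 / (x 0 * u 0),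
    -(x 3) / (x 0 * u 0), -(x 4) / x 0 + u 1 * x 3 / (x 0 * u 0), -(x 5) / x 0],
    ![1 / u 0, -(u 1) / u 0]), ?_, ?_⟩ <;>
  · refine Prod.ext ?_ ?_ <;> ext i <;> fin_cases i <;>
      simp only [qrm, qer, Fin.mk_zero, Fin.mk_one, Fin.reduceFinMk, Fin.zero_eta, Fin.isValue,
          Matrix.cons_val, Matrix.cons_val_zero, Matrix.cons_val_one] <;>
      field_simp <;> ring

lemma aux_linv (a : QDNA) (h1 : a.1 2 ≠ 0) (h2 : a.2 1 ≠ 0) : ∃ y, InvPair qlm qel a y := by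
  obtain ⟨x, u⟩ := a
  simp only at h1 h2
  refine ⟨(![-(x 0) / x 2 + u 0 * x 1 / (x 2 * u 1), -(x 1) / (x 2 * u 1), 1 / x 2,
    -(x 3) / x 2 + u 0 * x 4 / (x 2 * u 1), -(x 4) / (x 2 * u 1), -(x 5) / x 2],
    ![-(u 0) / u 1, 1 / u 1]), ?_, ?_⟩ <;>
  · refine Prod.ext ?_ ?_ <;> ext i <;> fin_cases i <;>
      simp only [qlm, qel, Fin.mk_zero, Fin.mk_one, Fin.reduceFinMk, Fin.zero_eta, Fin.isValue,
          Matrix.cons_val, Matrix.cons_val_zero, Matrix.cons_val_one] <;>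
      field_simp <;> ring

/-- A family in `Q` with lower coordinates `((u−s)/(u−r), (s−r)/(u−r))` is a two-way
flow iff there exist `α ≥ 0`, `ρ ∈ [0,1]`, `β ≥ −2√(α(1−ρ))` and `h₄ h₅ h₆ ∈ ℝ`
such that the upper coordinates are given by the stated formulas. -/
theorem stmt13 (x : ℝ → ℝ → ℝ → QDNA)
    (hlow : ∀ r s u : ℝ, 0 ≤ r → r < s → s < u →
      (x s r u).2 = ![(u - s) / (u - r), (s - r) / (u - r)]) :
    IsTwoWayFlowOps qlm qrm qel qer x ↔
    ∃ α ρ β h4 h5 h6 : ℝ, 0 ≤ α ∧ ρ ∈ Set.Icc (0 : ℝ) 1 ∧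
      -2 * Real.sqrt (α * (1 - ρ)) ≤ β ∧
      ∀ r s u : ℝ, 0 ≤ r → r < s → s < u →
        (x s r u).1 =
          ![(u - s) * cQ α β ρ s u / ((u - r) * cQ α β ρ r u),
            (s - r) * (u - s) * (2 * ρ - β) / ((u - r) * cQ α β ρ r u),
            (s - r) * cQ α β ρ r s / ((u - r) * cQ α β ρ r u),
            (u - s) * (s - r) * (h4 * u - h5 * (1 - u)) / ((u - r) * cQ α β ρ r u),
            (u - s) * (s - r) * (h5 * (1 - r) - h4 * r) / ((u - r) * cQ α β ρ r u),
            (u - s) * (s - r) * h6 / cQ α β ρ r u] := by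
  constructor
  · rintro ⟨hinv, hflow, hstr⟩
    obtain ⟨b, hb⟩ := aux_struct (fun s r u => (x s r u).1 0) 0 1 (by
      intro r s s' u h1 h2 h3 h4 h5
      exact congrFun (congrArg Prod.fst (hstr r s s' u h1 h2 h3 h4 h5)) 0)
    obtain ⟨D, hD⟩ := aux_struct (fun s r u => (x s r u).1 1) 0 0 (by
      intro r s s' u h1 h2 h3 h4 h5
      exact congrFun (congrArg Prod.fst (hstr r s s' u h1 h2 h3 h4 h5)) 1)
    obtain ⟨a, ha⟩ := aux_struct (fun s r u => (x s r u).1 2) 1 0 (by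
      intro r s s' u h1 h2 h3 h4 h5
      exact congrFun (congrArg Prod.fst (hstr r s s' u h1 h2 h3 h4 h5)) 2)
    obtain ⟨E, hE⟩ := aux_struct (fun s r u => (x s r u).1 3) 0 0 (by
      intro r s s' u h1 h2 h3 h4 h5
      exact congrFun (congrArg Prod.fst (hstr r s s' u h1 h2 h3 h4 h5)) 3)
    obtain ⟨F, hF⟩ := aux_struct (fun s r u => (x s r u).1 4) 0 0 (by
      intro r s s' u h1 h2 h3 h4 h5
      exact congrFun (congrArg Prod.fst (hstr r s s' u h1 h2 h3 h4 h5)) 4)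
    obtain ⟨H, hH⟩ := aux_struct (fun s r u => (x s r u).1 5) 0 0 (by
      intro r s s' u h1 h2 h3 h4 h5
      exact congrFun (congrArg Prod.fst (hstr r s s' u h1 h2 h3 h4 h5)) 5)
    have hu1 : ∀ r s u : ℝ, 0 ≤ r → r < s → s < u → (x s r u).2 0 = (u - s) / (u - r) := by
      intro r s u h1 h2 h3; rw [hlow r s u h1 h2 h3]; rfl
    have hu2 : ∀ r s u : ℝ, 0 ≤ r → r < s → s < u → (x s r u).2 1 = (s - r) / (u - r) := by
      intro r s u h1 h2 h3; rw [hlow r s u h1 h2 h3]; rfl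
    have fr : ∀ (i : Fin 6) (r s t u : ℝ), 0 ≤ r → r < s → s < t → t < u →
        (qrm (x s r u) (x t s u)).1 i = (x t r u).1 i := by
      intro i r s t u h1 h2 h3 h4; rw [(hflow r s t u h1 h2 h3 h4).1]
    have fl : ∀ (i : Fin 6) (r s t u : ℝ), 0 ≤ r → r < s → s < t → t < u →
        (qlm (x t r u) (x s r t)).1 i = (x s r u).1 i := by
      intro i r s t u h1 h2 h3 h4; rw [(hflow r s t u h1 h2 h3 h4).2]
    have nb : ∀ r s u : ℝ, 0 ≤ r → r < s → s < u → 1 + (s - r) * b r u ≠ 0 := by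
      intro r s u h1 h2 h3 h0
      obtain ⟨y, hy, -⟩ := (hinv r s u h1 h2 h3).2
      have := congrFun (congrArg Prod.fst hy) 0
      simp only [qrm, qer, Matrix.cons_val_zero] at this
      rw [hb r s u h1 h2 h3, show (s - r) * 0 + (u - s) * 1 + (u - s) * (s - r) * b r u = 0 by
        linear_combination (u - s) * h0] at this
      simp at this
    have na : ∀ r s u : ℝ, 0 ≤ r → r < s → s < u → 1 + (u - s) * a r u ≠ 0 := by
      intro r s u h1 h2 h3 h0
      obtain ⟨y, hy, -⟩ := (hinv r s u h1 h2 h3).1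
      have := congrFun (congrArg Prod.fst hy) 2
      simp only [qlm, qel, Matrix.cons_val] at this
      rw [ha r s u h1 h2 h3, show (s - r) * 1 + (u - s) * 0 + (u - s) * (s - r) * a r u = 0 by
        linear_combination (s - r) * h0] at this
      simp at this
    have R1 : ∀ r s u : ℝ, 0 ≤ r → r < s → s < u →
        b s u * (1 + (s - r) * b r u) = b r u := by
      intro r s u h1 h2 h3
      obtain ⟨t, h4, h5⟩ := exists_between h3
      have h := fr 0 r s t u h1 h2 h4 h5
      simp only [qrm, Matrix.cons_val] at h
      rw [hb r s u h1 h2 h3, hb s t u (by linarith) h4 h5, hb r t u h1 (by linarith) h5] at h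
      exact aux_R1 r s t u _ _ h2 h4 h5 h
    have L3 : ∀ r t u : ℝ, 0 ≤ r → r < t → t < u →
        a r t * (1 + (u - t) * a r u) = a r u := by
      intro r t u h1 h2 h3
      obtain ⟨s, h4, h5⟩ := exists_between h2
      have h := fl 2 r s t u h1 h4 h5 h3
      simp only [qlm, Matrix.cons_val] at h
      rw [ha r t u h1 h2 h3, ha r s t h1 h4 h5, ha r s u h1 h4 (by linarith)] at h
      exact aux_L3 r s t u _ _ h4 h5 h3 h
    have R2 : ∀ r s u : ℝ, 0 ≤ r → r < s → s < u →
        D s u * (1 + (s - r) * b r u) = D r u := by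
      intro r s u h1 h2 h3
      obtain ⟨t, h4, h5⟩ := exists_between h3
      have h := fr 1 r s t u h1 h2 h4 h5
      simp only [qrm, Matrix.cons_val] at h
      rw [hD r s u h1 h2 h3, hb s t u (by linarith) h4 h5, hu1 r s u h1 h2 h3,
        hD s t u (by linarith) h4 h5, hD r t u h1 (by linarith) h5] at h
      exact aux_R2 r s t u _ _ _ _ h2 h4 h5 (R1 r s u h1 h2 h3) h
    have R4 : ∀ r s u : ℝ, 0 ≤ r → r < s → s < u →
        E s u * (1 + (s - r) * b r u) = E r u := by
      intro r s u h1 h2 h3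
      obtain ⟨t, h4, h5⟩ := exists_between h3
      have h := fr 3 r s t u h1 h2 h4 h5
      simp only [qrm, Matrix.cons_val] at h
      rw [hE r s u h1 h2 h3, hb s t u (by linarith) h4 h5, hu1 r s u h1 h2 h3,
        hE s t u (by linarith) h4 h5, hE r t u h1 (by linarith) h5] at h
      exact aux_R2 r s t u _ _ _ _ h2 h4 h5 (R1 r s u h1 h2 h3) h
    have L2 : ∀ r t u : ℝ, 0 ≤ r → r < t → t < u →
        D r t * (1 + (u - t) * a r u) = D r u := by
      intro r t u h1 h2 h3
      obtain ⟨s, h4, h5⟩ := exists_between h2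
      have h := fl 1 r s t u h1 h4 h5 h3
      simp only [qlm, Matrix.cons_val] at h
      rw [hu2 r t u h1 h2 h3, hD r s t h1 h4 h5, hD r t u h1 h2 h3, ha r s t h1 h4 h5,
        hD r s u h1 h4 (by linarith)] at h
      exact aux_L2 r s t u _ _ _ _ h4 h5 h3 (L3 r t u h1 h2 h3) h
    have L5 : ∀ r t u : ℝ, 0 ≤ r → r < t → t < u →
        F r t * (1 + (u - t) * a r u) = F r u := by
      intro r t u h1 h2 h3
      obtain ⟨s, h4, h5⟩ := exists_between h2
      have h := fl 4 r s t u h1 h4 h5 h3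
      simp only [qlm, Matrix.cons_val] at h
      rw [hu2 r t u h1 h2 h3, hF r s t h1 h4 h5, hF r t u h1 h2 h3, ha r s t h1 h4 h5,
        hF r s u h1 h4 (by linarith), add_comm] at h
      exact aux_L2 r s t u _ _ _ _ h4 h5 h3 (L3 r t u h1 h2 h3) h
    have R3 : ∀ r s u : ℝ, 0 ≤ r → r < s → s < u →
        (u - r) * (a s u * (1 + (s - r) * b r u)) =
          (u - s) * a r u - (s - r) * (b r u + D r u) := by
      intro r s u h1 h2 h3
      obtain ⟨t, h4, h5⟩ := exists_between h3
      have h := fr 2 r s t u h1 h2 h4 h5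
      simp only [qrm, Matrix.cons_val] at h
      rw [ha r s u h1 h2 h3, hb s t u (by linarith) h4 h5, hu2 r s u h1 h2 h3,
        hD s t u (by linarith) h4 h5, ha s t u (by linarith) h4 h5,
        ha r t u h1 (by linarith) h5] at h
      exact aux_R3 r s t u _ _ _ _ _ _ h2 h4 h5 (R1 r s u h1 h2 h3) (R2 r s u h1 h2 h3) h
    have L1 : ∀ r t u : ℝ, 0 ≤ r → r < t → t < u →
        (u - r) * (b r t * (1 + (u - t) * a r u)) =
          (t - r) * b r u - (u - t) * (a r u + D r u) := by
      intro r t u h1 h2 h3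
      obtain ⟨s, h4, h5⟩ := exists_between h2
      have h := fl 0 r s t u h1 h4 h5 h3
      simp only [qlm, Matrix.cons_val] at h
      rw [hb r s t h1 h4 h5, hu1 r t u h1 h2 h3, hD r s t h1 h4 h5, hb r t u h1 h2 h3,
        ha r s t h1 h4 h5, hb r s u h1 h4 (by linarith)] at h
      exact aux_L1 r s t u _ _ _ _ _ _ h4 h5 h3 (L3 r t u h1 h2 h3) (L2 r t u h1 h2 h3) h
    have R5 : ∀ r s u : ℝ, 0 ≤ r → r < s → s < u →
        (s - r) * E r u + (u - r) * (F s u * (1 + (s - r) * b r u)) = (u - s) * F r u := by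
      intro r s u h1 h2 h3
      obtain ⟨t, h4, h5⟩ := exists_between h3
      have h := fr 4 r s t u h1 h2 h4 h5
      simp only [qrm, Matrix.cons_val] at h
      rw [hF r s u h1 h2 h3, hb s t u (by linarith) h4 h5, hu2 r s u h1 h2 h3,
        hE s t u (by linarith) h4 h5, hF s t u (by linarith) h4 h5,
        hF r t u h1 (by linarith) h5] at h
      exact aux_R5 r s t u _ _ _ _ _ _ h2 h4 h5 (R1 r s u h1 h2 h3) (R4 r s u h1 h2 h3) h
    have R6 : ∀ r s u : ℝ, 0 ≤ r → r < s → s < u →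
        H s u / (u - s) * (1 + (s - r) * b r u) = H r u / (u - r) := by
      intro r s u h1 h2 h3
      obtain ⟨t, h4, h5⟩ := exists_between h3
      have h := fr 5 r s t u h1 h2 h4 h5
      simp only [qrm, Matrix.cons_val] at h
      rw [hH r s u h1 h2 h3, hb s t u (by linarith) h4 h5,
        hH s t u (by linarith) h4 h5, hH r t u h1 (by linarith) h5] at h
      exact aux_R6 r s t u _ _ _ _ h2 h4 h5 (R1 r s u h1 h2 h3) h
    have L6 : ∀ r t u : ℝ, 0 ≤ r → r < t → t < u →
        H r t / (t - r) * (1 + (u - t) * a r u) = H r u / (u - r) := by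
      intro r t u h1 h2 h3
      obtain ⟨s, h4, h5⟩ := exists_between h2
      have h := fl 5 r s t u h1 h4 h5 h3
      simp only [qlm, Matrix.cons_val] at h
      rw [hH r s t h1 h4 h5, hH r t u h1 h2 h3, ha r s t h1 h4 h5,
        hH r s u h1 h4 (by linarith)] at h
      exact aux_L6 r s t u _ _ _ _ h4 h5 h3 (L3 r t u h1 h2 h3) h
    obtain ⟨α, ρ, β, h4, h5, h6, hall⟩ := aux_forward b a D E F (fun r u => H r u / (u - r))
      nb na R1 L3 R2 L2 R3 L1 R4 L5 R5 R6 L6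
    obtain ⟨p1, p2, p3⟩ := aux_params α ρ β (fun s u hs hu => (hall s u hs hu).1)
    refine ⟨α, ρ, β, h4, h5, h6, p1, p2, p3, fun r s u hr hs hu => ?_⟩
    obtain ⟨hc, q1, q2, q3, q4, q5, q6⟩ := hall r u hr (by linarith)
    have hur : u - r ≠ 0 := by linarith
    have hden : (u - r) * cQ α β ρ r u ≠ 0 := mul_ne_zero hur hc
    have c1 : cQ α β ρ s u = cQ α β ρ r u + (s - r) * (α * u + (β - ρ)) := by unfold cQ; ring
    have c2 : cQ α β ρ r s = cQ α β ρ r u - (u - s) * (ρ + α * r) := by unfold cQ; ring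
    ext i
    fin_cases i
    · change (x s r u).1 0 = (u - s) * cQ α β ρ s u / ((u - r) * cQ α β ρ r u)
      rw [hb r s u hr hs hu, div_eq_div_iff hur hden, c1, ← q1]; ring
    · change (x s r u).1 1 = (s - r) * (u - s) * (2 * ρ - β) / ((u - r) * cQ α β ρ r u)
      rw [hD r s u hr hs hu, div_eq_div_iff hur hden, ← q3]; ring
    · change (x s r u).1 2 = (s - r) * cQ α β ρ r s / ((u - r) * cQ α β ρ r u)
      rw [ha r s u hr hs hu, div_eq_div_iff hur hden, c2]
      linear_combination (u - r) * (u - s) * (s - r) * q2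
    · change (x s r u).1 3 =
        (u - s) * (s - r) * (h4 * u - h5 * (1 - u)) / ((u - r) * cQ α β ρ r u)
      rw [hE r s u hr hs hu, div_eq_div_iff hur hden, ← q4]; ring
    · change (x s r u).1 4 =
        (u - s) * (s - r) * (h5 * (1 - r) - h4 * r) / ((u - r) * cQ α β ρ r u)
      rw [hF r s u hr hs hu, div_eq_div_iff hur hden, ← q5]; ring
    · change (x s r u).1 5 = (u - s) * (s - r) * h6 / cQ α β ρ r u
      rw [hH r s u hr hs hu, div_eq_div_iff hur hc, ← q6]; field_simp; ring
  · rintro ⟨α, ρ, β, h4, h5, h6, hα, hρ, hβ, hx⟩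
    have hpos := aux_cpos α ρ β hα hρ hβ
    have hx' : ∀ r s u : ℝ, 0 ≤ r → r < s → s < u → x s r u =
        (![(u - s) * cQ α β ρ s u / ((u - r) * cQ α β ρ r u),
            (s - r) * (u - s) * (2 * ρ - β) / ((u - r) * cQ α β ρ r u),
            (s - r) * cQ α β ρ r s / ((u - r) * cQ α β ρ r u),
            (u - s) * (s - r) * (h4 * u - h5 * (1 - u)) / ((u - r) * cQ α β ρ r u),
            (u - s) * (s - r) * (h5 * (1 - r) - h4 * r) / ((u - r) * cQ α β ρ r u),
            (u - s) * (s - r) * h6 / cQ α β ρ r u],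
          ![(u - s) / (u - r), (s - r) / (u - r)]) :=
      fun r s u h1 h2 h3 => Prod.ext (hx r s u h1 h2 h3) (hlow r s u h1 h2 h3)
    refine ⟨fun r s u h1 h2 h3 => ?_, fun r s t u h1 h2 h3 h4' => ⟨?_, ?_⟩,
      fun r s s' u h1 h2 h3 h2' h3' => ?_⟩
    · have k1 : u - s ≠ 0 := by linarith
      have k2 : s - r ≠ 0 := by linarith
      have k3 : u - r ≠ 0 := by linarith
      have m1 : (x s r u).1 0 ≠ 0 := by
        rw [hx r s u h1 h2 h3]
        exact div_ne_zero (mul_ne_zero k1 (hpos s u (by linarith) h3).ne')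
          (mul_ne_zero k3 (hpos r u h1 (by linarith)).ne')
      have m2 : (x s r u).1 2 ≠ 0 := by
        rw [hx r s u h1 h2 h3]
        exact div_ne_zero (mul_ne_zero k2 (hpos r s h1 h2).ne')
          (mul_ne_zero k3 (hpos r u h1 (by linarith)).ne')
      have m3 : (x s r u).2 0 ≠ 0 := by
        rw [hlow r s u h1 h2 h3]; exact div_ne_zero k1 k3
      have m4 : (x s r u).2 1 ≠ 0 := by
        rw [hlow r s u h1 h2 h3]; exact div_ne_zero k2 k3
      exact ⟨aux_linv _ m2 m4, aux_rinv _ m1 m3⟩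
    · have k1 : u - s ≠ 0 := by linarith
      have k2 : u - r ≠ 0 := by linarith
      have n1 := (hpos r u h1 (by linarith)).ne'
      have n2 := (hpos s u (by linarith) (by linarith)).ne'
      rw [hx' r s u h1 h2 (by linarith), hx' s t u (by linarith) h3 h4',
        hx' r t u h1 (by linarith) h4']
      refine Prod.ext ?_ ?_ <;> ext i <;> fin_cases i <;>
        simp only [qrm, Fin.mk_zero, Fin.mk_one, Fin.reduceFinMk, Fin.zero_eta, Fin.isValue,
          Matrix.cons_val, Matrix.cons_val_zero, Matrix.cons_val_one] <;>
        field_simp <;> (try simp only [cQ]) <;> ring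
    · have k1 : t - r ≠ 0 := by linarith
      have k2 : u - r ≠ 0 := by linarith
      have n1 := (hpos r u h1 (by linarith)).ne'
      have n2 := (hpos r t h1 (by linarith)).ne'
      rw [hx' r t u h1 (by linarith) h4', hx' r s t h1 h2 h3, hx' r s u h1 h2 (by linarith)]
      refine Prod.ext ?_ ?_ <;> ext i <;> fin_cases i <;>
        simp only [qlm, Fin.mk_zero, Fin.mk_one, Fin.reduceFinMk, Fin.zero_eta, Fin.isValue,
          Matrix.cons_val, Matrix.cons_val_zero, Matrix.cons_val_one] <;>
        field_simp <;> (try simp only [cQ]) <;> ring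
    · have k1 : u - s ≠ 0 := by linarith
      have k2 : u - s' ≠ 0 := by linarith
      have k3 : s - r ≠ 0 := by linarith
      have k4 : s' - r ≠ 0 := by linarith
      have k5 : u - r ≠ 0 := by linarith
      have n1 := (hpos r u h1 (by linarith)).ne'
      rw [hx' r s u h1 h2 h3, hx' r s' u h1 h2' h3']
      refine Prod.ext ?_ ?_ <;> ext i <;> fin_cases i <;>
        simp only [qel, qer, Prod.fst_add, Prod.snd_add, Prod.smul_fst, Prod.smul_snd,
          Prod.fst_sub, Prod.snd_sub, Pi.add_apply, Pi.sub_apply, Pi.smul_apply, smul_eq_mul,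
          Fin.mk_zero, Fin.mk_one, Fin.reduceFinMk, Fin.zero_eta, Fin.isValue,
          Matrix.cons_val, Matrix.cons_val_zero, Matrix.cons_val_one] <;>
        field_simp <;> (try simp only [cQ]) <;> ring
end
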